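/- arXiv:1705.05298 — 3 statements merged into one kernel-verified Lean document; each statement's English description precedes it below -/
import Mathlib

section
/- For any n ≥ 1, the joint distribution of maj together with the descent bottom set and descent top set over 321-avoiding permutations of {1,...,n} equals the corresponding joint distribution of mak: Σ_{σ ∈ S_n(321)} q^{maj(σ)} x^{DB(σ)} y^{DT(σ)} = Σ_{σ ∈ S_n(321)} q^{mak(σ)} x^{DB(σ)} y^{DT(σ)}, where x^S = Π_{s∈S} x_s. -/
namespace MahonianStats

open Finset

/-- The value sequence of a permutation of `{1,…,n}`: position `i` (0-indexed)
carries the value `σ(i+1) ∈ {1,…,n}`; positions `≥ n` carry the junk value `0`. -/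
def pf {n : ℕ} (σ : Equiv.Perm (Fin n)) : ℕ → ℕ :=
  fun i => if h : i < n then ((σ ⟨i, h⟩ : Fin n) : ℕ) + 1 else 0

/-- The value sequence of a list (junk value `0` out of range). -/
def lf (l : List ℕ) : ℕ → ℕ := fun i => l.getD i 0

/-- Descent positions (0-indexed). -/
def desSet (n : ℕ) (f : ℕ → ℕ) : Finset ℕ :=
  (range (n - 1)).filter fun i => f (i + 1) < f i

def des (n : ℕ) (f : ℕ → ℕ) : ℕ := (desSet n f).card

/-- Major index: sum of (1-indexed) descent positions. -/
def maj (n : ℕ) (f : ℕ → ℕ) : ℕ := ∑ i ∈ desSet n f, (i + 1)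

/-- Occurrences of the vincular pattern (1-32). -/
def p1_32 (n : ℕ) (f : ℕ → ℕ) : ℕ :=
  ((range n ×ˢ range n).filter fun p =>
    p.1 < p.2 ∧ p.2 + 1 < n ∧ f p.1 < f (p.2 + 1) ∧ f (p.2 + 1) < f p.2).card

/-- Occurrences of the vincular pattern (31-2). -/
def p31_2 (n : ℕ) (f : ℕ → ℕ) : ℕ :=
  ((range n ×ˢ range n).filter fun p =>
    p.1 + 1 < p.2 ∧ f (p.1 + 1) < f p.2 ∧ f p.2 < f p.1).card

/-- Occurrences of the vincular pattern (32-1). -/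
def p32_1 (n : ℕ) (f : ℕ → ℕ) : ℕ :=
  ((range n ×ˢ range n).filter fun p =>
    p.1 + 1 < p.2 ∧ f p.2 < f (p.1 + 1) ∧ f (p.1 + 1) < f p.1).card

/-- Occurrences of the vincular pattern (21-3). -/
def p21_3 (n : ℕ) (f : ℕ → ℕ) : ℕ :=
  ((range n ×ˢ range n).filter fun p =>
    p.1 + 1 < p.2 ∧ f (p.1 + 1) < f p.1 ∧ f p.1 < f p.2).card

/-- Occurrences of the vincular pattern (3-21). -/
def p3_21 (n : ℕ) (f : ℕ → ℕ) : ℕ :=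
  ((range n ×ˢ range n).filter fun p =>
    p.1 < p.2 ∧ p.2 + 1 < n ∧ f (p.2 + 1) < f p.2 ∧ f p.2 < f p.1).card

/-- Occurrences of the vincular pattern (13-2). -/
def p13_2 (n : ℕ) (f : ℕ → ℕ) : ℕ :=
  ((range n ×ˢ range n).filter fun p =>
    p.1 + 1 < p.2 ∧ f p.1 < f p.2 ∧ f p.2 < f (p.1 + 1)).card

/-- Occurrences of the vincular pattern (2-13). -/
def p2_13 (n : ℕ) (f : ℕ → ℕ) : ℕ :=
  ((range n ×ˢ range n).filter fun p =>
    p.1 < p.2 ∧ p.2 + 1 < n ∧ f p.2 < f p.1 ∧ f p.1 < f (p.2 + 1)).card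

/-- Occurrences of the vincular pattern (2-31). -/
def p2_31 (n : ℕ) (f : ℕ → ℕ) : ℕ :=
  ((range n ×ˢ range n).filter fun p =>
    p.1 < p.2 ∧ p.2 + 1 < n ∧ f (p.2 + 1) < f p.1 ∧ f p.1 < f p.2).card

/-- Number of inversions. -/
def invp (n : ℕ) (f : ℕ → ℕ) : ℕ :=
  ((range n ×ˢ range n).filter fun p => p.1 < p.2 ∧ f p.2 < f p.1).card

def mak (n : ℕ) (f : ℕ → ℕ) : ℕ := p1_32 n f + p31_2 n f + p32_1 n f + des n f

def mad (n : ℕ) (f : ℕ → ℕ) : ℕ := 2 * p2_31 n f + p31_2 n f + des n f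

def Av123 (n : ℕ) (f : ℕ → ℕ) : Prop :=
  ¬ ∃ i j k, i < j ∧ j < k ∧ k < n ∧ f i < f j ∧ f j < f k
def Av132 (n : ℕ) (f : ℕ → ℕ) : Prop :=
  ¬ ∃ i j k, i < j ∧ j < k ∧ k < n ∧ f i < f k ∧ f k < f j
def Av213 (n : ℕ) (f : ℕ → ℕ) : Prop :=
  ¬ ∃ i j k, i < j ∧ j < k ∧ k < n ∧ f j < f i ∧ f i < f k
def Av231 (n : ℕ) (f : ℕ → ℕ) : Prop :=
  ¬ ∃ i j k, i < j ∧ j < k ∧ k < n ∧ f k < f i ∧ f i < f j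
def Av312 (n : ℕ) (f : ℕ → ℕ) : Prop :=
  ¬ ∃ i j k, i < j ∧ j < k ∧ k < n ∧ f j < f k ∧ f k < f i
def Av321 (n : ℕ) (f : ℕ → ℕ) : Prop :=
  ¬ ∃ i j k, i < j ∧ j < k ∧ k < n ∧ f k < f j ∧ f j < f i

/-- Set of descent bottoms. -/
def DB (n : ℕ) (f : ℕ → ℕ) : Finset ℕ := (desSet n f).image fun i => f (i + 1)

/-- Set of descent tops. -/
def DT (n : ℕ) (f : ℕ → ℕ) : Finset ℕ := (desSet n f).image fun i => f i


/-- number of elements of `A` at most `c` -/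
def cle {n : ℕ} (A : Finset (Fin n)) (c : Fin n) : ℕ := (A.filter fun x => x ≤ c).card
/-- number of elements of `A` less than `c` -/
def clt {n : ℕ} (A : Finset (Fin n)) (c : Fin n) : ℕ := (A.filter fun x => x < c).card

structure RunData {n : ℕ} (S T : Finset (Fin n)) (r : Fin n → ℕ) : Prop where
  disj : ∀ c, c ∈ S → c ∈ T → False
  card : S.card = T.card
  dom : ∀ c, cle T c ≤ cle S c
  alt : ∀ c, r c = clt T c ∨ r c = cle S c
  onT : ∀ c ∈ T, r c = clt T c
  onS : ∀ c ∈ S, r c = cle S c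

theorem cle_mono {n : ℕ} (A : Finset (Fin n)) {c d : Fin n} (h : c ≤ d) : cle A c ≤ cle A d :=
  card_le_card fun x hx => by simp only [mem_filter] at hx ⊢; exact ⟨hx.1, hx.2.trans h⟩

theorem clt_mono {n : ℕ} (A : Finset (Fin n)) {c d : Fin n} (h : c ≤ d) : clt A c ≤ clt A d :=
  card_le_card fun x hx => by
    simp only [mem_filter] at hx ⊢; exact ⟨hx.1, lt_of_lt_of_le hx.2 h⟩

theorem cle_le_clt {n : ℕ} (A : Finset (Fin n)) {c d : Fin n} (h : c < d) : cle A c ≤ clt A d :=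
  card_le_card fun x hx => by
    simp only [mem_filter] at hx ⊢; exact ⟨hx.1, lt_of_le_of_lt hx.2 h⟩

theorem clt_le_cle {n : ℕ} (A : Finset (Fin n)) (c : Fin n) : clt A c ≤ cle A c :=
  card_le_card fun x hx => by
    simp only [mem_filter] at hx ⊢; exact ⟨hx.1, hx.2.le⟩

theorem cle_of_mem {n : ℕ} {A : Finset (Fin n)} {c : Fin n} (h : c ∈ A) :
    cle A c = clt A c + 1 := by
  have : (A.filter fun x => x ≤ c) = insert c (A.filter fun x => x < c) := by
    ext x; simp only [mem_filter, mem_insert, le_iff_lt_or_eq]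
    constructor
    · rintro ⟨h1, h2 | h2⟩ <;> tauto
    · rintro (rfl | h) <;> tauto
  unfold cle clt
  rw [this, card_insert_of_notMem (by simp)]

theorem cle_of_notMem {n : ℕ} {A : Finset (Fin n)} {c : Fin n} (h : c ∉ A) :
    cle A c = clt A c := by
  unfold cle clt
  congr 1
  ext x; simp only [mem_filter, le_iff_lt_or_eq]
  constructor
  · rintro ⟨h1, h2 | rfl⟩ <;> tauto
  · tauto

theorem cle_le_card {n : ℕ} (A : Finset (Fin n)) (c : Fin n) : cle A c ≤ A.card :=
  card_le_card (filter_subset _ _)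

theorem clt_lt_card {n : ℕ} {A : Finset (Fin n)} {c : Fin n} (h : c ∈ A) : clt A c < A.card := by
  have := cle_le_card A c
  rw [cle_of_mem h] at this
  omega

theorem clt_lt_clt {n : ℕ} {A : Finset (Fin n)} {c d : Fin n} (h : c ∈ A) (hd : c < d) :
    clt A c < clt A d := by
  have := cle_le_clt A hd
  rw [cle_of_mem h] at this
  omega

theorem exists_clt {n : ℕ} (A : Finset (Fin n)) (u : ℕ) (hu : u < A.card) :
    ∃ a ∈ A, clt A a = u := by
  have h1 : A.image (clt A) ⊆ range A.card := by
    intro x hx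
    obtain ⟨a, ha, rfl⟩ := mem_image.1 hx
    exact mem_range.2 (clt_lt_card ha)
  have h2 : (A.image (clt A)).card = A.card := by
    apply card_image_of_injOn
    intro a ha b hb hab
    rcases lt_trichotomy a b with h | h | h
    · have := clt_lt_clt ha h; omega
    · exact h
    · have := clt_lt_clt hb h; omega
  have h3 := eq_of_subset_of_card_le h1 (by simp [h2])
  have : u ∈ A.image (clt A) := by rw [h3]; exact mem_range.2 hu
  simpa using this

theorem exists_cle {n : ℕ} (A : Finset (Fin n)) (u : ℕ) (h0 : 0 < u) (hu : u ≤ A.card) :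
    ∃ a ∈ A, cle A a = u := by
  obtain ⟨a, ha, h⟩ := exists_clt A (u - 1) (by omega)
  exact ⟨a, ha, by rw [cle_of_mem ha]; omega⟩

/-! ### counting identity -/

theorem sum_clt_add {n : ℕ} (A B : Finset (Fin n)) :
    ∑ c ∈ A, clt B c + ∑ c ∈ B, cle A c = A.card * B.card := by
  simp only [clt, cle, card_filter]
  rw [sum_comm (s := B) (t := A), ← sum_add_distrib]
  have : ∀ c ∈ A, (∑ i ∈ B, (if i < c then 1 else 0)) + (∑ i ∈ B, (if c ≤ i then 1 else 0))
      = B.card := by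
    intro c _
    rw [← sum_add_distrib, card_eq_sum_ones]
    apply sum_congr rfl
    intro i _
    by_cases h : i < c
    · simp [h, not_le.2 h]
    · simp [h, not_lt.1 h]
  rw [sum_congr rfl this]; simp

theorem sum_swap {n : ℕ} {S T : Finset (Fin n)} (hd : ∀ c, c ∈ S → c ∈ T → False)
    (hc : S.card = T.card) :
    ∑ c ∈ T, clt T c + ∑ c ∈ S, cle S c = ∑ c ∈ T, cle S c + ∑ c ∈ S, clt T c := by
  have h1 := sum_clt_add T S
  have h2 := sum_clt_add T T
  have h3 := sum_clt_add S S
  have e1 : ∑ c ∈ T, clt S c = ∑ c ∈ T, cle S c :=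
    sum_congr rfl fun c hc => (cle_of_notMem fun h => hd c h hc).symm
  have e2 : ∑ c ∈ S, cle T c = ∑ c ∈ S, clt T c :=
    sum_congr rfl fun c hc => (cle_of_notMem fun h => hd c hc h)
  have e3 : ∑ c ∈ T, cle T c = ∑ c ∈ T, clt T c + T.card := by
    rw [sum_congr rfl fun c hc => cle_of_mem hc, sum_add_distrib]; simp
  have e4 : ∑ c ∈ S, cle S c = ∑ c ∈ S, clt S c + S.card := by
    rw [sum_congr rfl fun c hc => cle_of_mem hc, sum_add_distrib]; simp
  rw [hc] at *
  omega

/-- swapped run index -/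
def rsw {n : ℕ} (S T : Finset (Fin n)) (r : Fin n → ℕ) (c : Fin n) : ℕ :=
  if c ∈ S ∪ T then r c else clt T c + cle S c - r c

theorem RunData.swap {n : ℕ} {S T : Finset (Fin n)} {r : Fin n → ℕ} (h : RunData S T r) :
    RunData S T (rsw S T r) where
  disj := h.disj
  card := h.card
  dom := h.dom
  alt c := by
    unfold rsw
    have := h.alt c
    split_ifs <;> omega
  onT c hc := by
    unfold rsw; rw [if_pos (by simp [hc])]; exact h.onT c hc
  onS c hc := by
    unfold rsw; rw [if_pos (by simp [hc])]; exact h.onS c hc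

theorem RunData.swap_swap {n : ℕ} {S T : Finset (Fin n)} {r : Fin n → ℕ} (h : RunData S T r) :
    rsw S T (rsw S T r) = r := by
  funext c
  unfold rsw
  have := h.alt c
  split_ifs <;> omega

theorem RunData.sum {n : ℕ} {S T : Finset (Fin n)} {r : Fin n → ℕ} (h : RunData S T r) :
    ∑ c, r c + ∑ c, rsw S T r c = ∑ c, clt T c + ∑ c, cle S c := by
  rw [← sum_add_distrib, ← sum_add_distrib]
  rw [← sum_sdiff (subset_univ (S ∪ T)), ← sum_sdiff (subset_univ (S ∪ T))]
  congr 1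
  · apply sum_congr rfl
    intro c hc
    have hc' : c ∉ S ∪ T := (mem_sdiff.1 hc).2
    have := h.alt c
    rw [rsw, if_neg hc']; omega
  · have hd : Disjoint S T := disjoint_left.2 fun {c} => h.disj c
    rw [sum_union hd, sum_union hd]
    have e1 : ∑ c ∈ S, (r c + rsw S T r c) = ∑ c ∈ S, (cle S c + cle S c) :=
      sum_congr rfl fun c hc => by rw [h.swap.onS c hc, h.onS c hc]
    have e2 : ∑ c ∈ T, (r c + rsw S T r c) = ∑ c ∈ T, (clt T c + clt T c) :=
      sum_congr rfl fun c hc => by rw [h.swap.onT c hc, h.onT c hc]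
    have := sum_swap h.disj h.card
    rw [e1, e2]
    simp only [sum_add_distrib]
    omega

theorem RunData.ge {n : ℕ} {S T : Finset (Fin n)} {r : Fin n → ℕ} (h : RunData S T r) (c) :
    clt T c ≤ r c := by
  have := h.alt c
  have := h.dom c
  have := clt_le_cle T c
  omega

theorem RunData.le {n : ℕ} {S T : Finset (Fin n)} {r : Fin n → ℕ} (h : RunData S T r) (c) :
    r c ≤ cle S c := by
  have := h.alt c
  have := h.dom c
  have := clt_le_cle T c
  omega

theorem RunData.maxT {n : ℕ} {S T : Finset (Fin n)} {r : Fin n → ℕ} (h : RunData S T r)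
    {c d} (hc : c ∈ T) (hd : c < d) : r c < r d := by
  have := clt_lt_clt hc hd
  have := h.ge d
  have := h.onT c hc
  omega

theorem RunData.minS {n : ℕ} {S T : Finset (Fin n)} {r : Fin n → ℕ} (h : RunData S T r)
    {c d} (hc : c ∈ S) (hd : d < c) : r d < r c := by
  have := cle_le_clt S hd
  have := h.le d
  have := h.onS c hc
  have := cle_of_mem hc
  omega

/-! ### descents in Fin -/

def D {m : ℕ} (σ : Equiv.Perm (Fin (m+1))) : Finset (Fin m) :=
  univ.filter fun x => σ x.succ < σ x.castSucc
def SS {m : ℕ} (σ : Equiv.Perm (Fin (m+1))) : Finset (Fin (m+1)) := (D σ).image fun x => σ x.succ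
def TT {m : ℕ} (σ : Equiv.Perm (Fin (m+1))) : Finset (Fin (m+1)) :=
  (D σ).image fun x => σ x.castSucc
def run {m : ℕ} (σ : Equiv.Perm (Fin (m+1))) (i : Fin (m+1)) : ℕ :=
  ((D σ).filter fun x => x.castSucc < i).card
def rr {m : ℕ} (σ : Equiv.Perm (Fin (m+1))) (c : Fin (m+1)) : ℕ := run σ (σ.symm c)

def Av {m : ℕ} (σ : Equiv.Perm (Fin (m+1))) : Prop :=
  ∀ i j k, i < j → j < k → σ j < σ i → σ k < σ j → False

theorem run_zero {m : ℕ} (σ : Equiv.Perm (Fin (m+1))) : run σ 0 = 0 := by simp [run]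

theorem run_succ {m : ℕ} (σ : Equiv.Perm (Fin (m+1))) (i : Fin m) :
    run σ i.succ = run σ i.castSucc + if σ i.succ < σ i.castSucc then 1 else 0 := by
  unfold run
  have e : ∀ x : Fin m, x.castSucc < i.succ ↔ x = i ∨ x.castSucc < i.castSucc := by
    intro x; simp only [Fin.lt_def, Fin.ext_iff]; simp; omega
  split_ifs with h
  · have : ((D σ).filter fun x => x.castSucc < i.succ) =
        insert i ((D σ).filter fun x => x.castSucc < i.castSucc) := by
      ext x
      have hi : i ∈ D σ := by simp [D, h]
      simp only [mem_filter, mem_insert, e]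
      constructor
      · tauto
      · rintro (rfl | h) <;> tauto
    rw [this, card_insert_of_notMem (by simp)]
  · rw [add_zero]; congr 1
    ext x
    have hi : i ∉ D σ := by simpa [D] using h
    simp only [mem_filter, e]
    constructor
    · rintro ⟨h1, rfl | h2⟩ <;> tauto
    · tauto

theorem run_mono {m : ℕ} (σ : Equiv.Perm (Fin (m+1))) : Monotone (run σ) := by
  intro i j hij
  exact card_le_card fun x hx => by
    simp only [mem_filter] at hx ⊢; exact ⟨hx.1, lt_of_lt_of_le hx.2 hij⟩

theorem sort_rr {m : ℕ} (σ : Equiv.Perm (Fin (m+1))) : Tuple.sort (rr σ) = σ := by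
  symm
  rw [Tuple.eq_sort_iff]
  have e : rr σ ∘ σ = run σ := by funext i; simp [rr]
  rw [e]
  refine ⟨run_mono σ, ?_⟩
  intro i j
  simp only [rr, Equiv.symm_apply_apply]
  induction j using Fin.induction with
  | zero => intro h; simp at h
  | succ j ih =>
    intro h h2
    have h3 := run_succ σ j
    have h4 : i ≤ j.castSucc := by simpa [Fin.le_castSucc_iff] using h
    have h5 := run_mono σ h4
    have h6 : ¬ σ j.succ < σ j.castSucc := by
      intro h7; rw [if_pos h7] at h3; omega
    rw [if_neg h6] at h3
    have h7 : σ j.castSucc < σ j.succ := by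
      refine lt_of_le_of_ne (not_lt.1 h6) fun h => ?_
      have := σ.injective h
      simp [Fin.ext_iff] at this
    rcases h4.lt_or_eq with h8 | h8
    · exact (ih h8 (by omega)).trans h7
    · rw [h8]; exact h7

/-! ### Claim 2: from run data to permutation -/

theorem av_of_runData {m : ℕ} {S T : Finset (Fin (m+1))} {r : Fin (m+1) → ℕ}
    (h : RunData S T r) {τ : Equiv.Perm (Fin (m+1))}
    (hmon : Monotone (r ∘ τ)) (htie : ∀ i j, i < j → r (τ i) = r (τ j) → τ i < τ j) : Av τ := by
  intro i j k hij hjk h1 h2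
  have a1 : r (τ i) < r (τ j) := lt_of_le_of_ne (hmon hij.le)
    fun e => absurd (htie i j hij e) (not_lt.2 h1.le)
  have a2 : r (τ j) < r (τ k) := lt_of_le_of_ne (hmon hjk.le)
    fun e => absurd (htie j k hjk e) (not_lt.2 h2.le)
  have := h.alt (τ i)
  have := h.alt (τ j)
  have := h.alt (τ k)
  have := clt_mono T h1.le
  have := clt_mono T h2.le
  have := cle_mono S h1.le
  have := cle_mono S h2.le
  omega

/-- a jump of the run index is a descent from `T` to `S` and has height one -/
theorem jump {m : ℕ} {S T : Finset (Fin (m+1))} {r : Fin (m+1) → ℕ}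
    (h : RunData S T r) {τ : Equiv.Perm (Fin (m+1))}
    (hmon : Monotone (r ∘ τ)) (htie : ∀ i j, i < j → r (τ i) = r (τ j) → τ i < τ j)
    (i : Fin m) (hlt : r (τ i.castSucc) < r (τ i.succ)) :
    τ i.castSucc ∈ T ∧ τ i.succ ∈ S ∧ r (τ i.succ) = r (τ i.castSucc) + 1 ∧
      τ i.succ < τ i.castSucc := by
  have hk : r (τ i.succ) ≤ S.card := (h.le _).trans (cle_le_card _ _)
  have hcard := h.card
  have split : ∀ p : Fin (m+1), p ≤ i.castSucc ∨ i.succ ≤ p := by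
    intro p; simp only [Fin.le_def]; simp; omega
  -- top
  have hT : τ i.castSucc ∈ T := by
    obtain ⟨a, haT, ha⟩ := exists_clt T (r (τ i.castSucc)) (by omega)
    have hra := h.onT a haT
    rcases split (τ.symm a) with hp | hp
    · rcases hp.lt_or_eq with hp | hp
      · have := htie _ _ hp (by simp; omega)
        simp only [Equiv.apply_symm_apply] at this
        have := h.maxT haT this
        omega
      · rw [← hp]; simpa using haT
    · have := hmon hp
      simp at this
      omega
  have hS : τ i.succ ∈ S := by
    obtain ⟨b, hbS, hb⟩ := exists_cle S (r (τ i.succ)) (by omega) hk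
    have hrb := h.onS b hbS
    rcases split (τ.symm b) with hp | hp
    · have := hmon hp
      simp at this
      omega
    · rcases hp.lt_or_eq with hp | hp
      · have := htie _ _ hp (by simp; omega)
        simp only [Equiv.apply_symm_apply] at this
        have := h.minS hbS this
        omega
      · rw [hp]; simpa using hbS
  have h1 : r (τ i.succ) = r (τ i.castSucc) + 1 := by
    obtain ⟨b, hbS, hb⟩ := exists_cle S (r (τ i.castSucc) + 1) (by omega) (by omega)
    have hrb := h.onS b hbS
    rcases split (τ.symm b) with hp | hp
    · have := hmon hp
      simp at this
      omega
    · have := hmon hp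
      simp at this
      omega
  refine ⟨hT, hS, h1, ?_⟩
  by_contra hc
  have hne : τ i.castSucc ≠ τ i.succ := fun e => h.disj _ hS (e ▸ hT)
  have hlt' : τ i.castSucc < τ i.succ := lt_of_le_of_ne (not_lt.1 hc) hne
  have e1 := h.onT _ hT
  have e2 := h.onS _ hS
  have e3 := cle_of_mem hT
  have e4 := cle_of_mem hS
  have e5 := h.dom (τ i.castSucc)
  have e6 := cle_le_clt S hlt'
  omega

theorem claim2 {m : ℕ} {S T : Finset (Fin (m+1))} {r : Fin (m+1) → ℕ}
    (h : RunData S T r) : Av (Tuple.sort r) ∧ SS (Tuple.sort r) = S ∧ TT (Tuple.sort r) = T ∧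
      rr (Tuple.sort r) = r := by
  obtain ⟨hmon, htie⟩ := Tuple.eq_sort_iff.1 (rfl : Tuple.sort r = Tuple.sort r)
  generalize Tuple.sort r = τ at *
  have hcard := h.card
  have hdesc : ∀ i : Fin m, τ i.succ < τ i.castSucc → r (τ i.castSucc) < r (τ i.succ) := by
    intro i hi
    have hl : i.castSucc < i.succ := Fin.castSucc_lt_succ
    exact lt_of_le_of_ne (hmon hl.le) fun e => absurd (htie _ _ hl e) (not_lt.2 hi.le)
  have hzero : r (τ 0) = 0 := by
    have : ∃ c, r c = 0 := by
      rcases Nat.eq_zero_or_pos S.card with h0 | h0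
      · refine ⟨0, ?_⟩
        have := h.le 0
        have := cle_le_card S 0
        omega
      · obtain ⟨a, haT, ha⟩ := exists_clt T 0 (by omega)
        exact ⟨a, by rw [h.onT a haT, ha]⟩
    obtain ⟨c, hc⟩ := this
    have := hmon (Fin.zero_le (τ.symm c))
    simp at this
    omega
  have hrun : ∀ i, run τ i = r (τ i) := by
    intro i
    induction i using Fin.induction with
    | zero => rw [run_zero, hzero]
    | succ i ih =>
      rw [run_succ, ih]
      split_ifs with hd
      · exact (jump h hmon htie i (hdesc i hd)).2.2.1.symm
      · have hl : i.castSucc < i.succ := Fin.castSucc_lt_succ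
        have h1 : r (τ i.castSucc) ≤ r (τ i.succ) := hmon hl.le
        rcases h1.lt_or_eq with h2 | h2
        · exact absurd (jump h hmon htie i h2).2.2.2 hd
        · omega
  refine ⟨av_of_runData h hmon htie, ?_, ?_, ?_⟩
  · ext c
    simp only [SS, mem_image, D, mem_filter, mem_univ, true_and]
    constructor
    · rintro ⟨x, hx, rfl⟩
      exact (jump h hmon htie x (hdesc x hx)).2.1
    · intro hc
      have hr := h.onS c hc
      have hr' := cle_of_mem hc
      obtain ⟨p, rfl⟩ := τ.surjective c
      induction p using Fin.cases with
      | zero => omega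
      | succ p =>
        refine ⟨p, ?_, rfl⟩
        have hl : p.castSucc < p.succ := Fin.castSucc_lt_succ
        have h1 : r (τ p.castSucc) ≤ r (τ p.succ) := hmon hl.le
        rcases h1.lt_or_eq with h2 | h2
        · exact (jump h hmon htie p h2).2.2.2
        · have := h.minS hc (htie _ _ hl h2)
          omega
  · ext c
    simp only [TT, mem_image, D, mem_filter, mem_univ, true_and]
    constructor
    · rintro ⟨x, hx, rfl⟩
      exact (jump h hmon htie x (hdesc x hx)).1
    · intro hc
      have hr := h.onT c hc
      have hr' := clt_lt_card hc
      obtain ⟨p, rfl⟩ := τ.surjective c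
      induction p using Fin.lastCases with
      | last =>
        obtain ⟨b, hb, hb'⟩ := exists_cle S S.card (by omega) le_rfl
        have := h.onS b hb
        have := hmon (Fin.le_last (τ.symm b))
        simp at this
        omega
      | cast p =>
        refine ⟨p, ?_, rfl⟩
        have hl : p.castSucc < p.succ := Fin.castSucc_lt_succ
        have h1 : r (τ p.castSucc) ≤ r (τ p.succ) := hmon hl.le
        rcases h1.lt_or_eq with h2 | h2
        · exact (jump h hmon htie p h2).2.2.2
        · have := h.maxT hc (htie _ _ hl h2)
          omega
  · funext c
    rw [rr, hrun]; simp

/-! ### Claim 1: a 321-avoiding permutation yields run data -/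

theorem mem_D {m : ℕ} {σ : Equiv.Perm (Fin (m+1))} {x : Fin m} :
    x ∈ D σ ↔ σ x.succ < σ x.castSucc := by simp [D]

theorem top_max {m : ℕ} {σ : Equiv.Perm (Fin (m+1))} (h : Av σ) {x : Fin m} (hx : x ∈ D σ)
    {y : Fin (m+1)} (hy : y < x.castSucc) : σ y < σ x.castSucc := by
  by_contra hc
  have hne : σ x.castSucc ≠ σ y := fun e => hy.ne' (σ.injective e)
  exact h y x.castSucc x.succ hy Fin.castSucc_lt_succ (lt_of_le_of_ne (not_lt.1 hc) hne)
    (mem_D.1 hx)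

theorem bot_min {m : ℕ} {σ : Equiv.Perm (Fin (m+1))} (h : Av σ) {x : Fin m} (hx : x ∈ D σ)
    {y : Fin (m+1)} (hy : x.succ < y) : σ x.succ < σ y := by
  by_contra hc
  have hne : σ y ≠ σ x.succ := fun e => hy.ne' (σ.injective e)
  exact h x.castSucc x.succ y Fin.castSucc_lt_succ hy (mem_D.1 hx)
    (lt_of_le_of_ne (not_lt.1 hc) hne)

theorem inj_bot {m : ℕ} (σ : Equiv.Perm (Fin (m+1))) :
    Function.Injective fun x : Fin m => σ x.succ :=
  fun _ _ h => Fin.succ_injective _ (σ.injective h)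

theorem inj_top {m : ℕ} (σ : Equiv.Perm (Fin (m+1))) :
    Function.Injective fun x : Fin m => σ x.castSucc :=
  fun _ _ h => Fin.castSucc_injective _ (σ.injective h)

theorem card_SS {m : ℕ} (σ : Equiv.Perm (Fin (m+1))) : (SS σ).card = (D σ).card :=
  card_image_of_injective _ (inj_bot σ)

theorem card_TT {m : ℕ} (σ : Equiv.Perm (Fin (m+1))) : (TT σ).card = (D σ).card :=
  card_image_of_injective _ (inj_top σ)

theorem clt_TT {m : ℕ} (σ : Equiv.Perm (Fin (m+1))) (c) :
    clt (TT σ) c = ((D σ).filter fun x => σ x.castSucc < c).card := by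
  rw [clt, TT, filter_image, card_image_of_injective _ (inj_top σ)]

theorem cle_TT {m : ℕ} (σ : Equiv.Perm (Fin (m+1))) (c) :
    cle (TT σ) c = ((D σ).filter fun x => σ x.castSucc ≤ c).card := by
  rw [cle, TT, filter_image, card_image_of_injective _ (inj_top σ)]

theorem cle_SS {m : ℕ} (σ : Equiv.Perm (Fin (m+1))) (c) :
    cle (SS σ) c = ((D σ).filter fun x => σ x.succ ≤ c).card := by
  rw [cle, SS, filter_image, card_image_of_injective _ (inj_bot σ)]

theorem run_eq_clt {m : ℕ} {σ : Equiv.Perm (Fin (m+1))} (h : Av σ) (i : Fin (m+1))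
    (hi : ∀ y < i, σ y < σ i) : run σ i = clt (TT σ) (σ i) := by
  rw [run, clt_TT]
  congr 1
  apply filter_congr
  intro x hx
  constructor
  · exact fun h1 => hi _ h1
  · intro h1
    by_contra h2
    rcases (not_lt.1 h2).lt_or_eq with h3 | h3
    · exact absurd (top_max h hx h3) (not_lt.2 h1.le)
    · rw [h3] at h1; exact lt_irrefl _ h1

theorem run_eq_cle {m : ℕ} {σ : Equiv.Perm (Fin (m+1))} (h : Av σ) (i : Fin (m+1))
    (hi : ∀ y, i < y → σ i < σ y) : run σ i = cle (SS σ) (σ i) := by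
  rw [run, cle_SS]
  congr 1
  apply filter_congr
  intro x hx
  have e : x.castSucc < i ↔ x.succ ≤ i := by
    simp only [Fin.lt_def, Fin.le_def]; simp
  rw [e]
  constructor
  · intro h1
    rcases h1.lt_or_eq with h3 | h3
    · exact (bot_min h hx h3).le
    · rw [h3]
  · intro h1
    by_contra h2
    exact absurd (hi _ (not_le.1 h2)) (not_lt.2 h1)

theorem claim1 {m : ℕ} {σ : Equiv.Perm (Fin (m+1))} (h : Av σ) :
    RunData (SS σ) (TT σ) (rr σ) where
  disj c hS hT := by
    obtain ⟨x, hx, rfl⟩ := mem_image.1 hS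
    obtain ⟨y, hy, e⟩ := mem_image.1 hT
    have e := σ.injective e
    have h1 := mem_D.1 hx
    have h2 := mem_D.1 hy
    rw [e] at h2
    exact h _ _ _ Fin.castSucc_lt_succ (e ▸ Fin.castSucc_lt_succ) h1 h2
  card := by rw [card_SS, card_TT]
  dom c := by
    rw [cle_SS, cle_TT]
    exact card_le_card fun x hx => by
      simp only [mem_filter] at hx ⊢; exact ⟨hx.1, (mem_D.1 hx.1).le.trans hx.2⟩
  alt c := by
    obtain ⟨i, rfl⟩ := σ.surjective c
    simp only [rr, Equiv.symm_apply_apply]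
    by_cases h1 : ∀ y < i, σ y < σ i
    · exact Or.inl (run_eq_clt h i h1)
    · right
      apply run_eq_cle h
      push Not at h1
      obtain ⟨y, hy, h1⟩ := h1
      intro z hz
      by_contra h2
      have hn1 : σ i ≠ σ y := fun e => hy.ne' (σ.injective e)
      have hn2 : σ z ≠ σ i := fun e => hz.ne' (σ.injective e)
      exact h y i z hy hz (lt_of_le_of_ne h1 hn1) (lt_of_le_of_ne (not_lt.1 h2) hn2)
  onT c hT := by
    obtain ⟨x, hx, rfl⟩ := mem_image.1 hT
    simp only [rr, Equiv.symm_apply_apply]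
    exact run_eq_clt h _ fun y hy => top_max h hx hy
  onS c hS := by
    obtain ⟨x, hx, rfl⟩ := mem_image.1 hS
    simp only [rr, Equiv.symm_apply_apply]
    exact run_eq_cle h _ fun y hy => bot_min h hx hy

/-! ### the involution -/

def Phi {m : ℕ} (σ : Equiv.Perm (Fin (m+1))) : Equiv.Perm (Fin (m+1)) :=
  Tuple.sort (rsw (SS σ) (TT σ) (rr σ))

theorem Phi_spec {m : ℕ} {σ : Equiv.Perm (Fin (m+1))} (h : Av σ) :
    Av (Phi σ) ∧ SS (Phi σ) = SS σ ∧ TT (Phi σ) = TT σ ∧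
      rr (Phi σ) = rsw (SS σ) (TT σ) (rr σ) := claim2 (claim1 h).swap

theorem Phi_Phi {m : ℕ} {σ : Equiv.Perm (Fin (m+1))} (h : Av σ) : Phi (Phi σ) = σ := by
  obtain ⟨-, h1, h2, h3⟩ := Phi_spec h
  conv_lhs => rw [Phi]
  rw [h1, h2, h3, (claim1 h).swap_swap, sort_rr]

def majF {m : ℕ} (σ : Equiv.Perm (Fin (m+1))) : ℕ := ∑ x ∈ D σ, ((x : ℕ) + 1)

theorem majF_add {m : ℕ} (σ : Equiv.Perm (Fin (m+1))) :
    majF σ + ∑ c, rr σ c = (m + 1) * (D σ).card := by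
  have e : ∑ c, rr σ c = ∑ i, run σ i :=
    (Equiv.sum_comp σ.symm (run σ))
  rw [e]
  simp only [run, card_filter]
  rw [sum_comm, majF, ← sum_add_distrib]
  rw [sum_congr rfl (g := fun _ => m + 1), sum_const, smul_eq_mul, mul_comm]
  intro x _
  rw [← card_filter]
  have : (univ.filter fun i : Fin (m+1) => x.castSucc < i) = Ioi x.castSucc := by ext; simp
  rw [this, Fin.card_Ioi]
  simp; omega

theorem sum_clt_univ {m : ℕ} (A : Finset (Fin (m+1))) :
    ∑ c, clt A c + ∑ a ∈ A, ((a : ℕ) + 1) = (m + 1) * A.card := by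
  have := sum_clt_add univ A
  have e : ∀ c : Fin (m+1), cle univ c = (c : ℕ) + 1 := by
    intro c
    rw [cle, show (univ.filter fun x : Fin (m+1) => x ≤ c) = Iic c by ext; simp, Fin.card_Iic]
  simp only [e] at this
  simpa using this

theorem sum_cle_univ {m : ℕ} (A : Finset (Fin (m+1))) :
    ∑ c, cle A c + ∑ a ∈ A, (a : ℕ) = (m + 1) * A.card := by
  have := sum_clt_add A univ
  have e : ∀ c : Fin (m+1), clt univ c = (c : ℕ) := by
    intro c
    rw [clt, show (univ.filter fun x : Fin (m+1) => x < c) = Iio c by ext; simp, Fin.card_Iio]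
  simp only [e] at this
  rw [add_comm, this]; simp [mul_comm]

theorem majF_Phi {m : ℕ} {σ : Equiv.Perm (Fin (m+1))} (h : Av σ) :
    majF σ + majF (Phi σ) = ∑ x ∈ D σ, ((σ x.succ : ℕ) + (σ x.castSucc : ℕ) + 1) := by
  obtain ⟨-, h1, h2, h3⟩ := Phi_spec h
  have a1 := majF_add σ
  have a2 := majF_add (Phi σ)
  rw [← card_SS, h1, card_SS, h3] at a2
  have a3 := (claim1 h).sum
  have a4 := sum_clt_univ (TT σ)
  have a5 := sum_cle_univ (SS σ)
  rw [card_TT, TT, sum_image (inj_top σ).injOn, ← TT] at a4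
  rw [card_SS, SS, sum_image (inj_bot σ).injOn, ← SS] at a5
  simp only [sum_add_distrib] at a4 a5 ⊢
  omega

/-! ### bridge to the official definitions -/

theorem pf_val {m : ℕ} (σ : Equiv.Perm (Fin (m+1))) (i : Fin (m+1)) :
    pf σ (i : ℕ) = (σ i : ℕ) + 1 := by simp [pf, i.is_le]

theorem pf_cast {m : ℕ} (σ : Equiv.Perm (Fin (m+1))) (i : Fin m) :
    pf σ (i : ℕ) = (σ i.castSucc : ℕ) + 1 := pf_val σ i.castSucc

theorem pf_succ {m : ℕ} (σ : Equiv.Perm (Fin (m+1))) (i : Fin m) :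
    pf σ ((i : ℕ) + 1) = (σ i.succ : ℕ) + 1 := pf_val σ i.succ

theorem desSet_eq {m : ℕ} (σ : Equiv.Perm (Fin (m+1))) :
    desSet (m+1) (pf σ) = (D σ).map Fin.valEmbedding := by
  ext x
  simp only [desSet, mem_filter, mem_range, mem_map, Fin.valEmbedding_apply, Nat.add_sub_cancel]
  constructor
  · rintro ⟨h1, h2⟩
    refine ⟨⟨x, h1⟩, ?_, rfl⟩
    rw [mem_D, Fin.lt_def]
    have a := pf_cast σ ⟨x, h1⟩
    have b := pf_succ σ ⟨x, h1⟩
    simp only at a b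
    omega
  · rintro ⟨y, h1, rfl⟩
    rw [mem_D, Fin.lt_def] at h1
    refine ⟨y.2, ?_⟩
    rw [pf_cast, pf_succ]
    omega

theorem maj_eq {m : ℕ} (σ : Equiv.Perm (Fin (m+1))) : maj (m+1) (pf σ) = majF σ := by
  rw [maj, desSet_eq, sum_map]; rfl

theorem des_eq {m : ℕ} (σ : Equiv.Perm (Fin (m+1))) : des (m+1) (pf σ) = (D σ).card := by
  rw [des, desSet_eq, card_map]

theorem DB_eq {m : ℕ} (σ : Equiv.Perm (Fin (m+1))) :
    DB (m+1) (pf σ) = (SS σ).image fun c : Fin (m+1) => (c : ℕ) + 1 := by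
  rw [DB, desSet_eq, SS, map_eq_image, image_image, image_image]
  apply image_congr
  intro x _
  exact pf_succ σ x

theorem DT_eq {m : ℕ} (σ : Equiv.Perm (Fin (m+1))) :
    DT (m+1) (pf σ) = (TT σ).image fun c : Fin (m+1) => (c : ℕ) + 1 := by
  rw [DT, desSet_eq, TT, map_eq_image, image_image, image_image]
  apply image_congr
  intro x _
  exact pf_cast σ x

theorem Av_iff {m : ℕ} (σ : Equiv.Perm (Fin (m+1))) : Av321 (m+1) (pf σ) ↔ Av σ := by
  unfold Av321 Av
  constructor
  · intro h i j k h1 h2 h3 h4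
    apply h
    refine ⟨i, j, k, h1, h2, k.2, ?_, ?_⟩
    · rw [pf_val, pf_val]; have := Fin.lt_def.1 h4; omega
    · rw [pf_val, pf_val]; have := Fin.lt_def.1 h3; omega
  · rintro h ⟨i, j, k, h1, h2, h3, h4, h5⟩
    have e1 := pf_val σ ⟨i, by omega⟩
    have e2 := pf_val σ ⟨j, by omega⟩
    have e3 := pf_val σ ⟨k, by omega⟩
    simp only at e1 e2 e3
    refine h ⟨i, by omega⟩ ⟨j, by omega⟩ ⟨k, by omega⟩ (Fin.lt_def.2 h1) (Fin.lt_def.2 h2) ?_ ?_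
    · rw [Fin.lt_def]; omega
    · rw [Fin.lt_def]; omega

theorem p32_1_eq {m : ℕ} {σ : Equiv.Perm (Fin (m+1))} (h : Av σ) : p32_1 (m+1) (pf σ) = 0 := by
  rw [← Av_iff] at h
  rw [p32_1, card_eq_zero, filter_eq_empty_iff]
  rintro ⟨x, y⟩ hm ⟨h1, h2, h3⟩
  simp only [mem_product, mem_range] at hm
  exact h ⟨x, x + 1, y, by omega, h1, hm.2, h2, h3⟩

theorem card_lt {m : ℕ} (σ : Equiv.Perm (Fin (m+1))) (v : Fin (m+1)) :
    (univ.filter fun y => σ y < v).card = (v : ℕ) := by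
  have : (univ.filter fun y => σ y < v) = (Iio v).map σ.symm.toEmbedding := by
    ext y; simp
  rw [this, card_map, Fin.card_Iio]

theorem p1_32_eq {m : ℕ} {σ : Equiv.Perm (Fin (m+1))} (h : Av σ) :
    p1_32 (m+1) (pf σ) = ∑ x ∈ D σ, (σ x.succ : ℕ) := by
  rw [p1_32, card_filter, sum_product_right, sum_range_succ]
  simp only [lt_self_iff_false, false_and, and_false, if_false, sum_const_zero, add_zero]
  rw [sum_range, D, sum_filter]
  apply sum_congr rfl
  intro x _
  rw [sum_range]
  split_ifs with hx
  · rw [← card_lt σ (σ x.succ), card_filter]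
    apply sum_congr rfl
    intro y _
    congr 1
    rw [pf_val, pf_succ, pf_cast, eq_iff_iff]
    constructor
    · rintro ⟨-, -, h1, -⟩
      rw [Fin.lt_def]; omega
    · intro h1
      have hx' := Fin.lt_def.1 hx
      have h1' := Fin.lt_def.1 h1
      refine ⟨?_, by omega, by omega, by omega⟩
      by_contra hc
      by_cases hc2 : (y : ℕ) = x
      · have : y = x.castSucc := Fin.ext hc2
        subst this
        exact absurd h1 (not_lt.2 hx.le)
      · by_cases hc3 : (y : ℕ) = x + 1
        · have : y = x.succ := Fin.ext hc3
          subst this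
          exact lt_irrefl _ h1
        · have : x.succ < y := by rw [Fin.lt_def]; simp; omega
          exact absurd (bot_min h (mem_D.2 hx) this) (not_lt.2 h1.le)
  · apply sum_eq_zero
    intro y _
    rw [if_neg]
    rintro ⟨-, -, -, h1⟩
    rw [pf_succ, pf_cast] at h1
    exact hx (Fin.lt_def.2 (by omega))

theorem p31_2_eq {m : ℕ} {σ : Equiv.Perm (Fin (m+1))} (h : Av σ) :
    p31_2 (m+1) (pf σ) + majF σ = ∑ x ∈ D σ, (σ x.castSucc : ℕ) := by
  have key : p31_2 (m+1) (pf σ) = ∑ x ∈ D σ,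
      (univ.filter fun y : Fin (m+1) => x.succ < y ∧ σ y < σ x.castSucc).card := by
    rw [p31_2, card_filter, sum_product, sum_range_succ]
    have hz : (∑ y ∈ range (m+1), if (m + 1 < y ∧ pf σ (m+1) < pf σ y ∧ pf σ y < pf σ m)
        then 1 else 0) = 0 := by
      apply sum_eq_zero
      intro y hy
      rw [mem_range] at hy
      rw [if_neg]
      omega
    simp only [hz, add_zero]
    rw [sum_range, D, sum_filter]
    apply sum_congr rfl
    intro x _
    rw [sum_range]
    split_ifs with hx
    · rw [card_filter]
      apply sum_congr rfl
      intro y _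
      congr 1
      rw [pf_val, pf_succ, pf_cast, eq_iff_iff]
      constructor
      · rintro ⟨h1, h2, h3⟩
        exact ⟨by rw [Fin.lt_def]; simpa using h1, by rw [Fin.lt_def]; omega⟩
      · rintro ⟨h1, h2⟩
        have h3 := Fin.lt_def.1 (bot_min h (mem_D.2 hx) h1)
        have h4 := Fin.lt_def.1 h2
        have h5 := Fin.lt_def.1 h1
        rw [Fin.val_succ] at h5
        omega
    · apply sum_eq_zero
      intro y _
      rw [if_neg]
      rintro ⟨-, h1, h2⟩
      rw [pf_val, pf_succ] at h1
      rw [pf_val, pf_cast] at h2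
      exact hx (Fin.lt_def.2 (by omega))
  rw [key, majF, ← sum_add_distrib]
  apply sum_congr rfl
  intro x hx
  rw [← card_lt σ (σ x.castSucc)]
  have e : (univ.filter fun y => σ y < σ x.castSucc) =
      (univ.filter fun y : Fin (m+1) => x.succ < y ∧ σ y < σ x.castSucc) ∪
        insert x.succ (Iio x.castSucc) := by
    ext y
    simp only [mem_filter, mem_univ, true_and, mem_union, mem_insert, mem_Iio]
    constructor
    · intro h1
      by_cases h2 : x.succ < y
      · exact Or.inl ⟨h2, h1⟩
      · right
        have h3 : y ≠ x.castSucc := by rintro rfl; exact lt_irrefl _ h1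
        rw [Fin.lt_def] at h2 ⊢
        rw [Ne, Fin.ext_iff] at h3
        rw [Fin.ext_iff]
        simp at h2 h3 ⊢
        omega
    · rintro (⟨-, h1⟩ | rfl | h1)
      · exact h1
      · exact mem_D.1 hx
      · exact top_max h hx h1
  rw [e, card_union_of_disjoint, card_insert_of_notMem, Fin.card_Iio]
  · simp
  · simp only [mem_Iio, not_lt]; exact Fin.castSucc_lt_succ.le
  · rw [disjoint_left]
    intro y hy hy2
    simp only [mem_filter, mem_univ, true_and, mem_insert, mem_Iio] at hy hy2
    rcases hy2 with rfl | h2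
    · exact lt_irrefl _ hy.1
    · exact absurd (h2.trans Fin.castSucc_lt_succ) (not_lt.2 hy.1.le)

theorem mak_eq {m : ℕ} {σ : Equiv.Perm (Fin (m+1))} (h : Av σ) :
    mak (m+1) (pf σ) = majF (Phi σ) := by
  have h1 := majF_Phi h
  have h2 := p31_2_eq h
  have h3 := p1_32_eq h
  rw [mak, p32_1_eq h, des_eq]
  simp only [sum_add_distrib, sum_const, smul_eq_mul, mul_one] at h1
  omega

/-- over `S_n(321)`, `maj` and `mak` are jointly equidistributed with the
descent bottom set and descent top set. -/
theorem stmt2 (n : ℕ) (hn : 1 ≤ n) (k : ℕ) (S T : Finset ℕ) :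
    Set.ncard {σ : Equiv.Perm (Fin n) |
        Av321 n (pf σ) ∧ maj n (pf σ) = k ∧ DB n (pf σ) = S ∧ DT n (pf σ) = T} =
    Set.ncard {σ : Equiv.Perm (Fin n) |
        Av321 n (pf σ) ∧ mak n (pf σ) = k ∧ DB n (pf σ) = S ∧ DT n (pf σ) = T} := by
  obtain ⟨m, rfl⟩ : ∃ m, n = m + 1 := ⟨n - 1, by omega⟩
  symm
  apply Set.ncard_congr (fun σ _ => Phi σ)
  · rintro σ ⟨h, h1, h2, h3⟩
    rw [Av_iff] at h
    obtain ⟨a1, a2, a3, -⟩ := Phi_spec h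
    refine ⟨(Av_iff _).2 a1, ?_, ?_, ?_⟩
    · rw [maj_eq, ← mak_eq h, h1]
    · rw [DB_eq, a2, ← DB_eq, h2]
    · rw [DT_eq, a3, ← DT_eq, h3]
  · rintro σ τ ⟨h, -⟩ ⟨h', -⟩ e
    rw [Av_iff] at h h'
    rw [← Phi_Phi h, ← Phi_Phi h', e]
  · rintro σ ⟨h, h1, h2, h3⟩
    rw [Av_iff] at h
    obtain ⟨a1, a2, a3, -⟩ := Phi_spec h
    refine ⟨Phi σ, ⟨(Av_iff _).2 a1, ?_, ?_, ?_⟩, Phi_Phi h⟩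
    · rw [mak_eq a1, Phi_Phi h, ← maj_eq, h1]
    · rw [DB_eq, a2, ← DB_eq, h2]
    · rw [DT_eq, a3, ← DT_eq, h3]

end MahonianStats
end

section
/- The mak-Wilf classes of single patterns of length 3 are: {123}, {321}, {132, 312}, and {213, 231}. That is, Σ_{σ∈S_n(132)} q^{mak(σ)} = Σ_{σ∈S_n(312)} q^{mak(σ)} and Σ_{σ∈S_n(213)} q^{mak(σ)} = Σ_{σ∈S_n(231)} q^{mak(σ)} for all n, and no other equalities hold among the six patterns (the four listed classes have pairwise distinct generating functions for some n). -/
namespace MahonianStats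

open Finset

/-- Number of permutations of `{1,…,n}` avoiding a pattern (given by its avoidance
predicate `A`) with `mak` equal to `k`. -/
noncomputable def makCount (A : ℕ → (ℕ → ℕ) → Prop) (n k : ℕ) : ℕ :=
  Set.ncard {σ : Equiv.Perm (Fin n) | A n (pf σ) ∧ mak n (pf σ) = k}


/-! ### List level statistics -/

/-- Sum over descents of (descent bottom + number of later letters strictly between). -/
def mk : List ℕ → ℕ
  | a :: b :: t =>
      (if b < a then b + t.countP (fun x => decide (b < x ∧ x < a)) else 0) + mk (b :: t)
  | _ => 0

lemma mk_append_lt (A C : List ℕ) (h : ∀ a ∈ A, ∀ c ∈ C, a < c) :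
    mk (A ++ C) = mk A + mk C := by
  induction A with
  | nil => simp [mk]
  | cons a A ih =>
    have ih' := ih (fun x hx c hc => h x (List.mem_cons_of_mem _ hx) c hc)
    cases A with
    | nil =>
      cases C with
      | nil => simp [mk]
      | cons c C =>
        have := h a (by simp) c (by simp)
        simp [mk, not_lt.2 this.le]
    | cons b A =>
      have hc : C.countP (fun x => decide (b < x ∧ x < a)) = 0 := by
        rw [List.countP_eq_zero]
        intro x hx
        have := h a (by simp) x hx
        simp; omega
      simp only [List.cons_append, mk, List.countP_append, hc] at ih' ⊢
      rw [ih']; simp; ring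

lemma mk_append_gt (A : List ℕ) (c : ℕ) (t : List ℕ) (hA : A ≠ [])
    (h : ∀ a ∈ A, ∀ x ∈ c :: t, x < a) :
    mk (A ++ c :: t) = mk A + mk (c :: t) + (c + t.countP (fun x => decide (c < x))) := by
  induction A with
  | nil => exact absurd rfl hA
  | cons a A ih =>
    cases A with
    | nil =>
      have h1 := h a (by simp) c (by simp)
      have h2 : t.countP (fun x => decide (c < x ∧ x < a))
          = t.countP (fun x => decide (c < x)) := by
        apply List.countP_congr
        intro x hx
        have := h a (by simp) x (by simp [hx])
        simp [this]
      simp only [List.singleton_append, mk, h1, h2, if_true]; ring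
    | cons b A =>
      have ih' := ih (by simp) (fun x hx c hc => h x (List.mem_cons_of_mem _ hx) c hc)
      have hc : (c :: t).countP (fun x => decide (b < x ∧ x < a)) = 0 := by
        rw [List.countP_eq_zero]
        intro x hx
        have := h b (by simp) x hx
        simp; omega
      simp only [List.cons_append, mk, List.countP_append, hc] at ih' ⊢
      rw [ih']; simp; ring

lemma countP_lt_range' (o m v : ℕ) :
    (List.range' (o + 1) m).countP (fun x => decide (x < v)) = min (v - (o + 1)) m := by
  induction m generalizing o with
  | zero => simp
  | succ m ih =>
    rw [List.range'_succ, List.countP_cons, ih (o + 1)]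
    by_cases h : o + 1 < v <;> simp [h] <;> omega

lemma countP_gt_range' (o m v : ℕ) (h1 : o ≤ v) (h2 : v ≤ o + m) :
    (List.range' (o + 1) m).countP (fun x => decide (v < x)) = o + m - v := by
  induction m generalizing o with
  | zero => simp; omega
  | succ m ih =>
    rw [List.range'_succ, List.countP_cons]
    by_cases h : v < o + 1
    · have : v = o := by omega
      subst this
      have : (List.range' (v + 1 + 1) m).countP (fun x => decide (v < x)) = m := by
        rw [List.countP_eq_length.2]
        · simp
        · intro x hx
          simp [List.mem_range'_1] at hx
          simp; omega
      rw [this]; simp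
    · rw [ih (o + 1) (by omega) (by omega)]
      simp [h]; omega

lemma head_count (o m c : ℕ) (t : List ℕ) (h : (c :: t).Perm (List.range' (o + 1) m)) :
    c + t.countP (fun x => decide (c < x)) = o + m := by
  have hc : c ∈ List.range' (o + 1) m := h.mem_iff.1 (by simp)
  rw [List.mem_range'_1] at hc
  have := h.countP_eq (fun x => decide (c < x))
  rw [countP_gt_range' o m c (by omega) (by omega)] at this
  simp at this
  omega

lemma mk_append_gt' (o m : ℕ) (A C : List ℕ) (hA : A ≠ []) (hC : C ≠ [])
    (hp : C.Perm (List.range' (o + 1) m)) (h : ∀ a ∈ A, ∀ x ∈ C, x < a) :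
    mk (A ++ C) = mk A + mk C + (o + m) := by
  cases C with
  | nil => exact absurd rfl hC
  | cons c t => rw [mk_append_gt A c t hA h, head_count o m c t hp]

/-! ### Trees and words -/

inductive Tr : Type
  | nil : Tr
  | node : Tr → Tr → Tr

def Tr.size : Tr → ℕ
  | .nil => 0
  | .node S B => S.size + B.size + 1

/-- The word of a tree for a joining rule. -/
def wd (j : List ℕ → List ℕ → ℕ → List ℕ) : ℕ → Tr → List ℕ
  | _, .nil => []
  | o, .node S B => j (wd j o S) (wd j (o + S.size + 1) B) (o + S.size + 1)

structure JP (P : ℕ → ℕ → ℕ → Prop) (j : List ℕ → List ℕ → ℕ → List ℕ) : Prop where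
  perm : ∀ S B k, (j S B k).Perm (k :: (S ++ B))
  key : ∀ S B k S' B' k', j S B k = j S' B' k' → k = k'
  filt : ∀ S B k, (∀ x ∈ S, x < k) → (∀ x ∈ B, k < x) →
    (j S B k).filter (fun x => decide (x < k)) = S ∧
    (j S B k).filter (fun x => decide (k < x)) = B
  av : ∀ S B k, (∀ x ∈ S, x < k) → (∀ x ∈ B, k < x) →
    ((j S B k).Triplewise P ↔ S.Triplewise P ∧ B.Triplewise P)
  ex : ∀ l : List ℕ, l ≠ [] → l.Nodup → l.Triplewise P →
    ∃ S B k, l = j S B k ∧ (∀ x ∈ S, x < k) ∧ (∀ x ∈ B, k < x)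

section generic
variable {P : ℕ → ℕ → ℕ → Prop} {j : List ℕ → List ℕ → ℕ → List ℕ}

lemma wd_perm (h : JP P j) (T : Tr) (o : ℕ) : (wd j o T).Perm (List.range' (o + 1) T.size) := by
  induction T generalizing o with
  | nil => simp [wd, Tr.size]
  | node S B ihS ihB =>
    simp only [wd, Tr.size]
    refine (h.perm _ _ _).trans ?_
    have e : List.range' (o + 1) (S.size + B.size + 1)
        = List.range' (o + 1) S.size ++ (o + S.size + 1) ::
          List.range' (o + S.size + 1 + 1) B.size := by
      rw [← List.range'_succ, show o + S.size + 1 = o + 1 + S.size by ring,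
        List.range'_append_1]
      congr 1
    rw [e]
    refine List.Perm.trans ?_ List.perm_middle.symm
    exact ((ihS o).append (ihB _)).cons _

lemma wd_mem (h : JP P j) (T : Tr) (o x : ℕ) : x ∈ wd j o T ↔ o < x ∧ x ≤ o + T.size := by
  rw [(wd_perm h T o).mem_iff, List.mem_range'_1]; omega

lemma wd_bd (h : JP P j) (S B : Tr) (o : ℕ) : (∀ x ∈ wd j o S, x < o + S.size + 1) ∧
    (∀ x ∈ wd j (o + S.size + 1) B, o + S.size + 1 < x) := by
  constructor
  · intro x hx; rw [wd_mem h] at hx; omega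
  · intro x hx; rw [wd_mem h] at hx; omega

lemma wd_av (h : JP P j) (T : Tr) (o : ℕ) : (wd j o T).Triplewise P := by
  induction T generalizing o with
  | nil => simp [wd]
  | node S B ihS ihB =>
    simp only [wd]
    exact (h.av _ _ _ (wd_bd h S B o).1 (wd_bd h S B o).2).2 ⟨ihS _, ihB _⟩

lemma wd_ne (h : JP P j) (S B : Tr) (o : ℕ) : wd j o (.node S B) ≠ [] := by
  intro e
  have := (wd_perm h (.node S B) o).length_eq
  rw [e] at this
  simp [Tr.size] at this

lemma wd_inj (h : JP P j) (T T' : Tr) (o : ℕ) (e : wd j o T = wd j o T') : T = T' := by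
  induction T generalizing o T' with
  | nil =>
    cases T' with
    | nil => rfl
    | node S' B' => exact absurd e.symm (wd_ne h S' B' o)
  | node S B ihS ihB =>
    cases T' with
    | nil => exact absurd e (wd_ne h S B o)
    | node S' B' =>
      simp only [wd] at e
      have hk := h.key _ _ _ _ _ _ e
      have f1 := h.filt _ _ _ (wd_bd h S B o).1 (wd_bd h S B o).2
      have f2 := h.filt _ _ _ (wd_bd h S' B' o).1 (wd_bd h S' B' o).2
      rw [e, hk] at f1
      have hS := ihS S' o (f1.1.symm.trans f2.1)
      subst hS
      have hB := ihB B' _ (f1.2.symm.trans f2.2)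
      subst hB
      rfl

lemma wd_surj (h : JP P j) (m : ℕ) : ∀ (o : ℕ) (l : List ℕ),
    l.Perm (List.range' (o + 1) m) → l.Triplewise P → ∃ T : Tr, T.size = m ∧ wd j o T = l := by
  induction m using Nat.strong_induction_on with
  | _ m ih =>
    intro o l hp ha
    by_cases hl : l = []
    · subst hl
      have := hp.length_eq
      simp at this
      exact ⟨.nil, by simp [Tr.size, ← this], rfl⟩
    have hnd : l.Nodup := hp.symm.nodup List.nodup_range'
    obtain ⟨S, B, k, rfl, hS, hB⟩ := h.ex l hl hnd ha
    have ha' := (h.av _ _ _ hS hB).1 ha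
    have hq := h.perm S B k
    have hmem : ∀ x, (x = k ∨ x ∈ S ∨ x ∈ B) ↔ (o < x ∧ x ≤ o + m) := by
      intro x
      have h1 := hp.mem_iff (a := x)
      rw [hq.mem_iff, List.mem_range'_1] at h1
      simp only [List.mem_cons, List.mem_append] at h1
      rw [h1]; omega
    have hnd' := hq.nodup hnd
    rw [List.nodup_cons, List.nodup_append] at hnd'
    obtain ⟨-, nS, nB, -⟩ := hnd'
    have hk := (hmem k).1 (Or.inl rfl)
    have pS : S.Perm (List.range' (o + 1) (k - o - 1)) := by
      rw [List.perm_ext_iff_of_nodup nS List.nodup_range']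
      intro x
      rw [List.mem_range'_1]
      constructor
      · intro hx
        have := (hmem x).1 (Or.inr (Or.inl hx))
        have := hS x hx
        omega
      · intro hx
        rcases (hmem x).2 (by omega) with h1 | h1 | h1
        · omega
        · exact h1
        · have := hB x h1; omega
    have pB : B.Perm (List.range' (k + 1) (o + m - k)) := by
      rw [List.perm_ext_iff_of_nodup nB List.nodup_range']
      intro x
      rw [List.mem_range'_1]
      constructor
      · intro hx
        have := (hmem x).1 (Or.inr (Or.inr hx))
        have := hB x hx
        omega
      · intro hx
        rcases (hmem x).2 (by omega) with h1 | h1 | h1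
        · omega
        · have := hS x h1; omega
        · exact h1
    obtain ⟨TS, sS, rfl⟩ := ih _ (by omega) _ _ pS ha'.1
    obtain ⟨TB, sB, rfl⟩ := ih _ (by omega) _ _ pB ha'.2
    refine ⟨.node TS TB, by simp only [Tr.size]; omega, ?_⟩
    have : o + TS.size + 1 = k := by omega
    simp only [wd, this]

lemma list_count (h : JP P j) (n k : ℕ) :
    Set.ncard {l : List ℕ | l.Perm (List.range' 1 n) ∧ l.Triplewise P ∧ mk l = k} =
    Set.ncard {T : Tr | T.size = n ∧ mk (wd j 0 T) = k} := by
  rw [← Set.ncard_image_of_injective _ (fun T T' e => wd_inj h T T' 0 e)]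
  congr 1
  ext l
  simp only [Set.mem_ofPred_eq, Set.mem_image]
  constructor
  · rintro ⟨h1, h2, h3⟩
    obtain ⟨T, hT, e⟩ := wd_surj h n 0 l (by simpa using h1) h2
    exact ⟨T, ⟨hT, by rw [e, h3]⟩, e⟩
  · rintro ⟨T, ⟨hT, h3⟩, rfl⟩
    have := wd_perm h T 0
    rw [hT] at this
    exact ⟨by simpa using this, wd_av h T 0, h3⟩

end generic

/-! ### The four joining rules -/

lemma split_of_pairwise (p : ℕ → Bool) (l : List ℕ)
    (h : l.Pairwise (fun x y => p x = true → p y = true)) :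
    l = l.filter (fun x => !p x) ++ l.filter p := by
  induction l with
  | nil => rfl
  | cons a l ih =>
    rw [List.pairwise_cons] at h
    by_cases ha : p a = true
    · have h1 : l.filter p = l := List.filter_eq_self.2 (fun x hx => h.1 x hx ha)
      have h2 : l.filter (fun x => !p x) = [] := by
        rw [List.filter_eq_nil_iff]
        intro x hx
        simp [h.1 x hx ha]
      simp [ha, h1, h2]
    · simp only [Bool.not_eq_true] at ha
      simp [ha]
      exact ih h.2

def j132 (S B : List ℕ) (k : ℕ) : List ℕ := (B ++ S) ++ [k]
def j312 (S B : List ℕ) (k : ℕ) : List ℕ := (S ++ B) ++ [k]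
def j213 (S B : List ℕ) (k : ℕ) : List ℕ := k :: (B ++ S)
def j231 (S B : List ℕ) (k : ℕ) : List ℕ := k :: (S ++ B)

def P132 (a b c : ℕ) : Prop := ¬ (a < c ∧ c < b)
def P312 (a b c : ℕ) : Prop := ¬ (b < c ∧ c < a)
def P213 (a b c : ℕ) : Prop := ¬ (b < a ∧ a < c)
def P231 (a b c : ℕ) : Prop := ¬ (c < a ∧ a < b)

lemma filt_aux (S B : List ℕ) (k : ℕ) (hS : ∀ x ∈ S, x < k) (hB : ∀ x ∈ B, k < x) :
    S.filter (fun x => decide (x < k)) = S ∧ S.filter (fun x => decide (k < x)) = [] ∧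
    B.filter (fun x => decide (x < k)) = [] ∧ B.filter (fun x => decide (k < x)) = B := by
  refine ⟨List.filter_eq_self.2 ?_, List.filter_eq_nil_iff.2 ?_, List.filter_eq_nil_iff.2 ?_,
    List.filter_eq_self.2 ?_⟩
  · intro x hx; simpa using hS x hx
  · intro x hx; have := hS x hx; simp; omega
  · intro x hx; have := hB x hx; simp; omega
  · intro x hx; simpa using hB x hx

/-- large letters first -/
lemma split_desc (k : ℕ) (l : List ℕ) (hk : k ∉ l)
    (h : l.Pairwise (fun x y => ¬ (x < k ∧ k < y))) :
    ∃ S B : List ℕ, l = B ++ S ∧ (∀ x ∈ S, x < k) ∧ (∀ x ∈ B, k < x) := by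
  refine ⟨_, _, split_of_pairwise (fun x => decide (x < k)) l ?_, ?_, ?_⟩
  · refine List.Pairwise.imp_of_mem ?_ h
    intro a b ha hb hab
    have : b ≠ k := fun e => hk (e ▸ hb)
    simp; omega
  · intro x hx; simpa using (List.mem_filter.1 hx).2
  · intro x hx
    have h1 := List.mem_filter.1 hx
    have : x ≠ k := fun e => hk (e ▸ h1.1)
    have := h1.2
    simp at this; omega

/-- small letters first -/
lemma split_asc (k : ℕ) (l : List ℕ) (hk : k ∉ l)
    (h : l.Pairwise (fun x y => ¬ (y < k ∧ k < x))) :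
    ∃ S B : List ℕ, l = S ++ B ∧ (∀ x ∈ S, x < k) ∧ (∀ x ∈ B, k < x) := by
  refine ⟨_, _, split_of_pairwise (fun x => decide (k < x)) l ?_, ?_, ?_⟩
  · refine List.Pairwise.imp_of_mem ?_ h
    intro a b ha hb hab
    have : b ≠ k := fun e => hk (e ▸ hb)
    simp; omega
  · intro x hx
    have h1 := List.mem_filter.1 hx
    have : x ≠ k := fun e => hk (e ▸ h1.1)
    have := h1.2
    simp at this; omega
  · intro x hx; simpa using (List.mem_filter.1 hx).2

/-- Pairwise statements that hold for all pairs of elements. -/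
lemma pw_all (l : List ℕ) (R : ℕ → ℕ → Prop) (h : ∀ x ∈ l, ∀ y ∈ l, R x y) : l.Pairwise R :=
  List.pairwise_iff_forall_sublist.2 fun {a b} hs =>
    h a (hs.subset (by simp)) b (hs.subset (by simp))

lemma jp132 : JP P132 j132 where
  perm S B k := (List.perm_append_singleton k _).trans (List.perm_append_comm.cons k)
  key S B k S' B' k' e := by
    have := (List.append_inj' e rfl).2
    simpa using this
  filt S B k hS hB := by
    obtain ⟨h1, h2, h3, h4⟩ := filt_aux S B k hS hB
    simp [j132, h1, h2, h3, h4]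
  av S B k hS hB := by
    simp only [j132, List.triplewise_append]
    constructor
    · rintro ⟨⟨h1, h2, -⟩, -⟩; exact ⟨h2, h1⟩
    · rintro ⟨h1, h2⟩
      refine ⟨⟨h2, h1, ?_, ?_⟩, by simp, by simp, ?_⟩
      · intro a ha
        refine pw_all _ _ fun x hx y hy => ?_
        have := hB a ha; have := hS x hx; have := hS y hy
        unfold P132; omega
      · intro a ha
        refine pw_all _ _ fun x hx y hy => ?_
        have := hS a ha; have := hB x hx; have := hB y hy
        unfold P132; omega
      · intro a ha
        rw [List.mem_singleton] at ha
        subst ha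
        rw [List.pairwise_append]
        refine ⟨pw_all _ _ fun x hx y hy => ?_, pw_all _ _ fun x hx y hy => ?_,
          fun x hx y hy => ?_⟩
        · have := hB x hx; unfold P132; omega
        · have := hS y hy; unfold P132; omega
        · have := hB x hx; unfold P132; omega
  ex l hl hnd ha := by
    obtain ⟨t, k, rfl⟩ := List.eq_nil_or_concat' l |>.resolve_left hl
    rw [List.triplewise_append] at ha
    have hk : k ∉ t := by
      intro hk
      exact (List.nodup_append.1 hnd).2.2 k hk k (by simp) rfl
    obtain ⟨S, B, rfl, hS, hB⟩ := split_desc k t hk ((ha.2.2.2 k (by simp)).imp (by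
      intro a b h; unfold P132 at h; omega))
    exact ⟨S, B, k, rfl, hS, hB⟩

lemma jp312 : JP P312 j312 where
  perm S B k := List.perm_append_singleton k _
  key S B k S' B' k' e := by
    have := (List.append_inj' e rfl).2
    simpa using this
  filt S B k hS hB := by
    obtain ⟨h1, h2, h3, h4⟩ := filt_aux S B k hS hB
    simp [j312, h1, h2, h3, h4]
  av S B k hS hB := by
    simp only [j312, List.triplewise_append]
    constructor
    · rintro ⟨⟨h1, h2, -⟩, -⟩; exact ⟨h1, h2⟩
    · rintro ⟨h1, h2⟩
      refine ⟨⟨h1, h2, ?_, ?_⟩, by simp, by simp, ?_⟩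
      · intro a ha
        refine pw_all _ _ fun x hx y hy => ?_
        have := hS a ha; have := hB x hx; have := hB y hy
        unfold P312; omega
      · intro a ha
        refine pw_all _ _ fun x hx y hy => ?_
        have := hB a ha; have := hS x hx; have := hS y hy
        unfold P312; omega
      · intro a ha
        rw [List.mem_singleton] at ha
        subst ha
        rw [List.pairwise_append]
        refine ⟨pw_all _ _ fun x hx y hy => ?_, pw_all _ _ fun x hx y hy => ?_,
          fun x hx y hy => ?_⟩
        · have := hS x hx; unfold P312; omega
        · have := hB y hy; unfold P312; omega
        · have := hS x hx; unfold P312; omega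
  ex l hl hnd ha := by
    obtain ⟨t, k, rfl⟩ := List.eq_nil_or_concat' l |>.resolve_left hl
    rw [List.triplewise_append] at ha
    have hk : k ∉ t := by
      intro hk
      exact (List.nodup_append.1 hnd).2.2 k hk k (by simp) rfl
    obtain ⟨S, B, rfl, hS, hB⟩ := split_asc k t hk ((ha.2.2.2 k (by simp)).imp (by
      intro a b h; unfold P312 at h; omega))
    exact ⟨S, B, k, rfl, hS, hB⟩

lemma jp213 : JP P213 j213 where
  perm S B k := List.perm_append_comm.cons k
  key S B k S' B' k' e := (List.cons.inj e).1
  filt S B k hS hB := by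
    obtain ⟨h1, h2, h3, h4⟩ := filt_aux S B k hS hB
    simp [j213, h1, h2, h3, h4]
  av S B k hS hB := by
    simp only [j213, List.triplewise_append, List.triplewise_cons]
    constructor
    · rintro ⟨-, h1, h2, -⟩; exact ⟨h2, h1⟩
    · rintro ⟨h1, h2⟩
      refine ⟨?_, h2, h1, ?_, ?_⟩
      · rw [List.pairwise_append]
        refine ⟨pw_all _ _ fun x hx y hy => ?_, pw_all _ _ fun x hx y hy => ?_,
          fun x hx y hy => ?_⟩
        · have := hB x hx; unfold P213; omega
        · have := hS y hy; unfold P213; omega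
        · have := hB x hx; unfold P213; omega
      · intro a ha
        refine pw_all _ _ fun x hx y hy => ?_
        have := hB a ha; have := hS x hx; have := hS y hy
        unfold P213; omega
      · intro a ha
        refine pw_all _ _ fun x hx y hy => ?_
        have := hS a ha; have := hB x hx; have := hB y hy
        unfold P213; omega
  ex l hl hnd ha := by
    cases l with
    | nil => exact absurd rfl hl
    | cons k t =>
      rw [List.triplewise_cons] at ha
      obtain ⟨S, B, rfl, hS, hB⟩ := split_desc k t (List.nodup_cons.1 hnd).1 (ha.1.imp (by
        intro a b h; unfold P213 at h; omega))
      exact ⟨S, B, k, rfl, hS, hB⟩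

lemma jp231 : JP P231 j231 where
  perm S B k := List.Perm.refl _
  key S B k S' B' k' e := (List.cons.inj e).1
  filt S B k hS hB := by
    obtain ⟨h1, h2, h3, h4⟩ := filt_aux S B k hS hB
    simp [j231, h1, h2, h3, h4]
  av S B k hS hB := by
    simp only [j231, List.triplewise_append, List.triplewise_cons]
    constructor
    · rintro ⟨-, h1, h2, -⟩; exact ⟨h1, h2⟩
    · rintro ⟨h1, h2⟩
      refine ⟨?_, h1, h2, ?_, ?_⟩
      · rw [List.pairwise_append]
        refine ⟨pw_all _ _ fun x hx y hy => ?_, pw_all _ _ fun x hx y hy => ?_,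
          fun x hx y hy => ?_⟩
        · have := hS x hx; unfold P231; omega
        · have := hB y hy; unfold P231; omega
        · have := hS x hx; unfold P231; omega
      · intro a ha
        refine pw_all _ _ fun x hx y hy => ?_
        have := hS a ha; have := hB x hx; have := hB y hy
        unfold P231; omega
      · intro a ha
        refine pw_all _ _ fun x hx y hy => ?_
        have := hB a ha; have := hS x hx; have := hS y hy
        unfold P231; omega
  ex l hl hnd ha := by
    cases l with
    | nil => exact absurd rfl hl
    | cons k t =>
      rw [List.triplewise_cons] at ha
      obtain ⟨S, B, rfl, hS, hB⟩ := split_asc k t (List.nodup_cons.1 hnd).1 (ha.1.imp (by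
        intro a b h; unfold P231 at h; omega))
      exact ⟨S, B, k, rfl, hS, hB⟩

/-! ### Statistic of the words -/

lemma mk_singleton (k : ℕ) : mk [k] = 0 := rfl

lemma mk_j132 (o s : ℕ) (S B : List ℕ) (pS : S.Perm (List.range' (o + 1) s))
    (hS : ∀ x ∈ S, x < o + s + 1) (hB : ∀ x ∈ B, o + s + 1 < x) :
    mk (j132 S B (o + s + 1)) = mk S + mk B + if B = [] then 0 else o + s + 1 := by
  have e1 : mk (S ++ [o + s + 1]) = mk S := by
    rw [mk_append_lt]
    · rfl
    · intro a ha c hc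
      rw [List.mem_singleton.1 hc]; exact hS a ha
  have pC : (S ++ [o + s + 1]).Perm (List.range' (o + 1) (s + 1)) := by
    rw [List.range'_1_concat, show o + s + 1 = o + 1 + s by ring]
    exact pS.append_right _
  rw [j132, List.append_assoc]
  split_ifs with h
  · subst h; simp [e1, mk]
  · rw [mk_append_gt' o (s + 1) _ _ h (by simp) pC, e1]
    · ring
    · intro a ha x hx
      have h1 := hB a ha
      rcases List.mem_append.1 hx with hx | hx
      · have := hS x hx; omega
      · rw [List.mem_singleton] at hx; omega

lemma mk_j312 (o s : ℕ) (S B : List ℕ)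
    (hS : ∀ x ∈ S, x < o + s + 1) (hB : ∀ x ∈ B, o + s + 1 < x) :
    mk (j312 S B (o + s + 1)) = mk S + mk B + if B = [] then 0 else o + s + 1 := by
  rw [j312, List.append_assoc, mk_append_lt]
  · split_ifs with h
    · subst h; simp [mk]
    · rw [mk_append_gt' (o + s) 1 _ _ h (by simp) (by simp)]
      · rw [mk_singleton]; ring
      · intro a ha x hx
        rw [List.mem_singleton] at hx
        have := hB a ha; omega
  · intro a ha c hc
    have := hS a ha
    rcases List.mem_append.1 hc with hc | hc
    · have := hB c hc; omega
    · rw [List.mem_singleton] at hc; omega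

lemma mk_j213 (o s : ℕ) (S B : List ℕ) (pS : S.Perm (List.range' (o + 1) s))
    (hS : ∀ x ∈ S, x < o + s + 1) (hB : ∀ x ∈ B, o + s + 1 < x) :
    mk (j213 S B (o + s + 1)) = mk S + mk B + if S = [] then 0 else o + s := by
  have e1 : mk ((o + s + 1) :: B) = mk B := by
    have := mk_append_lt [o + s + 1] B (by simpa using hB)
    simpa [mk_singleton] using this
  rw [j213, ← List.cons_append]
  split_ifs with h
  · subst h; simp [e1, mk]
  · rw [mk_append_gt' o s _ _ (by simp) h pS, e1]
    · ring
    · intro a ha x hx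
      have h1 := hS x hx
      rcases List.mem_cons.1 ha with ha | ha
      · omega
      · have := hB a ha; omega

lemma mk_j231 (o s : ℕ) (S B : List ℕ) (pS : S.Perm (List.range' (o + 1) s))
    (hS : ∀ x ∈ S, x < o + s + 1) (hB : ∀ x ∈ B, o + s + 1 < x) :
    mk (j231 S B (o + s + 1)) = mk S + mk B + if S = [] then 0 else o + s := by
  rw [j231, ← List.cons_append, mk_append_lt]
  · split_ifs with h
    · subst h; simp [mk]
    · have := mk_append_gt' o s [o + s + 1] S (by simp) h pS (by simpa using hS)
      rw [List.singleton_append] at this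
      rw [this, mk_singleton]; ring
  · intro a ha c hc
    have := hB c hc
    rcases List.mem_cons.1 ha with ha | ha
    · omega
    · have := hS a ha; omega

lemma wd_nil_iff {P : ℕ → ℕ → ℕ → Prop} {j : List ℕ → List ℕ → ℕ → List ℕ} (h : JP P j)
    (T : Tr) (o : ℕ) : wd j o T = [] ↔ T.size = 0 := by
  rw [← List.length_eq_zero_iff, (wd_perm h T o).length_eq]; simp

lemma mk_wd_1 (T : Tr) (o : ℕ) : mk (wd j132 o T) = mk (wd j312 o T) := by
  induction T generalizing o with
  | nil => rfl
  | node S B ihS ihB =>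
    simp only [wd]
    rw [mk_j132 _ _ _ _ (wd_perm jp132 S o) (wd_bd jp132 S B o).1 (wd_bd jp132 S B o).2,
      mk_j312 _ _ _ _ (wd_bd jp312 S B o).1 (wd_bd jp312 S B o).2, ihS, ihB]
    simp only [wd_nil_iff jp132, wd_nil_iff jp312]

lemma mk_wd_2 (T : Tr) (o : ℕ) : mk (wd j213 o T) = mk (wd j231 o T) := by
  induction T generalizing o with
  | nil => rfl
  | node S B ihS ihB =>
    simp only [wd]
    rw [mk_j213 _ _ _ _ (wd_perm jp213 S o) (wd_bd jp213 S B o).1 (wd_bd jp213 S B o).2,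
      mk_j231 _ _ _ _ (wd_perm jp231 S o) (wd_bd jp231 S B o).1 (wd_bd jp231 S B o).2, ihS, ihB]
    simp only [wd_nil_iff jp213, wd_nil_iff jp231]

/-! ### From permutations to lists -/

lemma countP_sum (p : ℕ → Prop) [DecidablePred p] (l : List ℕ) :
    l.countP (fun x => decide (p x)) = ∑ i ∈ range l.length, if p (lf l i) then 1 else 0 := by
  induction l with
  | nil => simp
  | cons a l ih =>
    rw [List.length_cons, Finset.sum_range_succ', List.countP_cons, ih]
    simp [lf]

lemma mk_sum (l : List ℕ) :
    mk l = ∑ j ∈ range (l.length - 1), if lf l (j + 1) < lf l j then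
      lf l (j + 1) + ∑ k ∈ range l.length,
        (if j + 1 < k ∧ lf l (j + 1) < lf l k ∧ lf l k < lf l j then 1 else 0) else 0 := by
  induction l with
  | nil => simp [mk]
  | cons a l ih =>
    cases l with
    | nil => simp [mk]
    | cons b t =>
      have e : (a :: b :: t).length - 1 = (b :: t).length - 1 + 1 := by simp
      rw [e, Finset.sum_range_succ', mk, ih, add_comm]
      congr 1
      · apply Finset.sum_congr rfl
        intro j _
        have hs : ∀ i, lf (a :: b :: t) (i + 1) = lf (b :: t) i := fun i => by simp [lf]
        rw [hs, hs, show (a :: b :: t).length = (b :: t).length + 1 from rfl,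
          Finset.sum_range_succ']
        simp only [hs]
        simp
      · have := countP_sum (fun x => b < x ∧ x < a) t
        rw [this, show (a :: b :: t).length = t.length + 1 + 1 from rfl,
          Finset.sum_range_succ', Finset.sum_range_succ']
        simp [lf]

lemma mak_sum (l : List ℕ) (hp : l.Perm (List.range' 1 l.length)) :
    mak l.length (lf l) = mk l := by
  rcases Nat.eq_zero_or_pos l.length with h0 | h0
  · rw [List.length_eq_zero_iff] at h0
    subst h0
    simp [mak, mk, p1_32, p31_2, p32_1, des, desSet]
  obtain ⟨m, hm⟩ : ∃ m, l.length = m + 1 := ⟨l.length - 1, by omega⟩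
  have hcount : ∀ j < m, 1 + ∑ i ∈ range (m + 1), (if lf l i < lf l (j + 1) then 1 else 0)
      = lf l (j + 1) := by
    intro j hj
    have h1 := countP_sum (fun x => x < lf l (j + 1)) l
    rw [hp.countP_eq, countP_lt_range' 0 l.length, hm] at h1
    have h2 : lf l (j + 1) ∈ l := by
      unfold lf
      rw [List.getD_eq_getElem _ _ (by omega)]
      exact List.getElem_mem _
    rw [hp.mem_iff, List.mem_range'_1] at h2
    omega
  rw [mk_sum, hm]
  set f := lf l with hf
  have a1 : p1_32 (m + 1) f = ∑ j ∈ range m, ∑ i ∈ range (m + 1),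
      if i < j ∧ f i < f (j + 1) ∧ f (j + 1) < f j then 1 else 0 := by
    rw [p1_32, Finset.card_filter, Finset.sum_product_right, Finset.sum_range_succ]
    simp only [lt_irrefl, false_and, and_false, if_false, Finset.sum_const_zero, add_zero]
    refine Finset.sum_congr rfl fun j hj => Finset.sum_congr rfl fun i hi => ?_
    have : j + 1 < m + 1 := by simpa using hj
    simp only [this, true_and]
  have a2 : p31_2 (m + 1) f = ∑ j ∈ range m, ∑ k ∈ range (m + 1),
      if j + 1 < k ∧ f (j + 1) < f k ∧ f k < f j then 1 else 0 := by
    rw [p31_2, Finset.card_filter, Finset.sum_product, Finset.sum_range_succ]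
    rw [Finset.sum_eq_zero (s := range (m + 1)), add_zero]
    intro k hk
    rw [Finset.mem_range] at hk
    rw [if_neg (by omega)]
  have a3 : p32_1 (m + 1) f = ∑ j ∈ range m, ∑ k ∈ range (m + 1),
      if j + 1 < k ∧ f k < f (j + 1) ∧ f (j + 1) < f j then 1 else 0 := by
    rw [p32_1, Finset.card_filter, Finset.sum_product, Finset.sum_range_succ]
    rw [Finset.sum_eq_zero (s := range (m + 1)), add_zero]
    intro k hk
    rw [Finset.mem_range] at hk
    rw [if_neg (by omega)]
  have a4 : des (m + 1) f = ∑ j ∈ range m, if f (j + 1) < f j then 1 else 0 := by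
    rw [des, desSet, Finset.card_filter]; rfl
  rw [mak, a1, a2, a3, a4, ← Finset.sum_add_distrib, ← Finset.sum_add_distrib,
    ← Finset.sum_add_distrib, Nat.add_sub_cancel]
  refine Finset.sum_congr rfl fun j hj => ?_
  have hj' : j < m := by simpa using hj
  by_cases hd : f (j + 1) < f j
  · simp only [hd, and_true, if_true]
    have e : ∑ i ∈ range (m + 1), (if f i < f (j + 1) then 1 else 0) =
        ∑ i ∈ range (m + 1), (if i < j ∧ f i < f (j + 1) then 1 else 0) +
        ∑ i ∈ range (m + 1), (if j + 1 < i ∧ f i < f (j + 1) then 1 else 0) := by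
      rw [← Finset.sum_add_distrib]
      refine Finset.sum_congr rfl fun i hi => ?_
      rcases lt_trichotomy i j with h | h | h
      · have : ¬ j + 1 < i := by omega
        simp [h, this]
      · subst h
        have : ¬ f i < f (i + 1) := by omega
        simp [this]
      · rcases Nat.lt_or_ge (j + 1) i with h' | h'
        · have : ¬ i < j := by omega
          simp [this, h']
        · have : i = j + 1 := by omega
          subst this
          simp
    have := hcount j hj'
    omega
  · have z : ∀ k, ¬ (j + 1 < k ∧ f (j + 1) < f k ∧ f k < f j) := by intro k; omega
    simp [hd, z]

def toL {n : ℕ} (σ : Equiv.Perm (Fin n)) : List ℕ := List.ofFn fun i => (σ i : ℕ) + 1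

lemma pf_eq {n : ℕ} (σ : Equiv.Perm (Fin n)) : pf σ = lf (toL σ) := by
  funext i
  unfold pf lf toL
  split_ifs with h
  · rw [List.getD_eq_getElem _ _ (by simpa using h)]; simp
  · rw [List.getD_eq_default _ _ (by simpa using h)]

lemma toL_length {n : ℕ} (σ : Equiv.Perm (Fin n)) : (toL σ).length = n := by simp [toL]

lemma toL_inj {n : ℕ} : Function.Injective (toL (n := n)) := by
  intro σ τ h
  have := List.ofFn_injective h
  ext i
  have := congrFun this i
  simpa using this

lemma toL_perm {n : ℕ} (σ : Equiv.Perm (Fin n)) : (toL σ).Perm (List.range' 1 n) := by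
  rw [List.perm_ext_iff_of_nodup _ List.nodup_range']
  · intro x
    rw [List.mem_range'_1, toL, List.mem_ofFn]
    constructor
    · rintro ⟨i, rfl⟩; have := (σ i).2; omega
    · intro h
      refine ⟨σ.symm ⟨x - 1, by omega⟩, ?_⟩
      simp; omega
  · rw [toL, List.nodup_ofFn]
    intro i j h
    have : (σ i : ℕ) = σ j := by simpa using h
    exact σ.injective (Fin.ext this)

lemma toL_surj {n : ℕ} (l : List ℕ) (hp : l.Perm (List.range' 1 n)) :
    ∃ σ : Equiv.Perm (Fin n), toL σ = l := by
  have hl : l.length = n := by simpa using hp.length_eq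
  subst hl
  have hnd : l.Nodup := hp.symm.nodup List.nodup_range'
  have hb : ∀ i : Fin l.length, 1 ≤ l[i] ∧ l[i] ≤ l.length := by
    intro i
    have : l[i] ∈ List.range' 1 l.length := hp.mem_iff.1 (List.getElem_mem _)
    rw [List.mem_range'_1] at this
    omega
  let g : Fin l.length → Fin l.length := fun i => ⟨l[i] - 1, by have := hb i; omega⟩
  have hg : Function.Injective g := by
    intro i j h
    have h1 := hb i
    have h2 := hb j
    have h3 : l[i] - 1 = l[j] - 1 := congrArg Fin.val h
    have h4 : l[i] = l[j] := by omega
    exact Fin.ext ((hnd.getElem_inj_iff).1 h4)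
  refine ⟨Equiv.ofBijective g (Finite.injective_iff_bijective.1 hg), ?_⟩
  apply List.ext_getElem
  · simp [toL]
  · intro i h1 h2
    have := hb ⟨i, h2⟩
    simp only [Fin.getElem_fin] at this
    simp [toL, g]
    omega

lemma makCount_list (A : ℕ → (ℕ → ℕ) → Prop) (P : ℕ → ℕ → ℕ → Prop)
    (hA : ∀ l : List ℕ, A l.length (lf l) ↔ l.Triplewise P) (n k : ℕ) :
    makCount A n k =
      Set.ncard {l : List ℕ | l.Perm (List.range' 1 n) ∧ l.Triplewise P ∧ mk l = k} := by
  rw [makCount, ← Set.ncard_image_of_injective _ (toL_inj (n := n))]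
  have hm : ∀ σ : Equiv.Perm (Fin n), mak n (pf σ) = mk (toL σ) := by
    intro σ
    have h := mak_sum (toL σ) (by rw [toL_length]; exact toL_perm σ)
    rw [toL_length] at h
    rw [pf_eq, h]
  have ha : ∀ σ : Equiv.Perm (Fin n), A n (pf σ) ↔ (toL σ).Triplewise P := by
    intro σ
    have h := hA (toL σ)
    rw [toL_length] at h
    rw [pf_eq, h]
  congr 1
  ext l
  simp only [Set.mem_ofPred_eq, Set.mem_image]
  constructor
  · rintro ⟨σ, ⟨h1, h2⟩, rfl⟩
    exact ⟨toL_perm σ, (ha σ).1 h1, by rw [← hm, h2]⟩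
  · rintro ⟨h1, h2, h3⟩
    obtain ⟨σ, rfl⟩ := toL_surj l h1
    exact ⟨σ, ⟨(ha σ).2 h2, by rw [hm, h3]⟩, rfl⟩

lemma av_iff (R : ℕ → ℕ → ℕ → Prop) (l : List ℕ) :
    (¬ ∃ i j k, i < j ∧ j < k ∧ k < l.length ∧ R (lf l i) (lf l j) (lf l k)) ↔
      l.Triplewise (fun a b c => ¬ R a b c) := by
  rw [List.triplewise_iff_getElem]
  push Not
  have e : ∀ i (h : i < l.length), lf l i = l[i] := fun i h => List.getD_eq_getElem _ _ h
  constructor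
  · intro h i j k hij hjk hk
    have := h i j k hij hjk hk
    rwa [e i (by omega), e j (by omega), e k hk] at this
  · intro h i j k hij hjk hk
    have := h i j k hij hjk hk
    rwa [e i (by omega), e j (by omega), e k hk]

lemma eq1 (n k : ℕ) : makCount Av132 n k = makCount Av312 n k := by
  rw [makCount_list Av132 P132 (fun l => av_iff (fun a b c => a < c ∧ c < b) l),
    makCount_list Av312 P312 (fun l => av_iff (fun a b c => b < c ∧ c < a) l),
    list_count jp132, list_count jp312]
  simp only [mk_wd_1]

lemma eq2 (n k : ℕ) : makCount Av213 n k = makCount Av231 n k := by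
  rw [makCount_list Av213 P213 (fun l => av_iff (fun a b c => b < a ∧ a < c) l),
    makCount_list Av231 P231 (fun l => av_iff (fun a b c => c < a ∧ a < b) l),
    list_count jp213, list_count jp231]
  simp only [mk_wd_2]

/-! ### Small values -/

lemma av3 (R : ℕ → ℕ → ℕ → Prop) (f : ℕ → ℕ) :
    (¬ ∃ i j k, i < j ∧ j < k ∧ k < 3 ∧ R (f i) (f j) (f k)) ↔ ¬ R (f 0) (f 1) (f 2) := by
  refine not_congr ⟨?_, fun h => ⟨0, 1, 2, by omega, by omega, by omega, h⟩⟩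
  rintro ⟨i, j, k, h1, h2, h3, h⟩
  obtain rfl : i = 0 := by omega
  obtain rfl : j = 1 := by omega
  obtain rfl : k = 2 := by omega
  exact h

lemma count3 (A : ℕ → (ℕ → ℕ) → Prop) (R : ℕ → ℕ → ℕ → Prop) [∀ a b c, Decidable (R a b c)]
    (hA : ∀ f, A 3 f ↔ ¬ R (f 0) (f 1) (f 2)) (k : ℕ) :
    makCount A 3 k = (univ.filter fun σ : Equiv.Perm (Fin 3) =>
      (¬ R (pf σ 0) (pf σ 1) (pf σ 2)) ∧ mak 3 (pf σ) = k).card := by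
  rw [makCount, ← Set.ncard_coe_finset]
  congr 1
  ext σ
  simp [hA]

lemma c123 (k : ℕ) : makCount Av123 3 k = (univ.filter fun σ : Equiv.Perm (Fin 3) =>
    (¬ (pf σ 0 < pf σ 1 ∧ pf σ 1 < pf σ 2)) ∧ mak 3 (pf σ) = k).card :=
  count3 Av123 (fun a b c => a < b ∧ b < c) (fun f => av3 (fun a b c => a < b ∧ b < c) f) k

lemma c132 (k : ℕ) : makCount Av132 3 k = (univ.filter fun σ : Equiv.Perm (Fin 3) =>
    (¬ (pf σ 0 < pf σ 2 ∧ pf σ 2 < pf σ 1)) ∧ mak 3 (pf σ) = k).card :=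
  count3 Av132 (fun a b c => a < c ∧ c < b) (fun f => av3 (fun a b c => a < c ∧ c < b) f) k

lemma c213 (k : ℕ) : makCount Av213 3 k = (univ.filter fun σ : Equiv.Perm (Fin 3) =>
    (¬ (pf σ 1 < pf σ 0 ∧ pf σ 0 < pf σ 2)) ∧ mak 3 (pf σ) = k).card :=
  count3 Av213 (fun a b c => b < a ∧ a < c) (fun f => av3 (fun a b c => b < a ∧ a < c) f) k

lemma c321 (k : ℕ) : makCount Av321 3 k = (univ.filter fun σ : Equiv.Perm (Fin 3) =>
    (¬ (pf σ 2 < pf σ 1 ∧ pf σ 1 < pf σ 0)) ∧ mak 3 (pf σ) = k).card :=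
  count3 Av321 (fun a b c => c < b ∧ b < a) (fun f => av3 (fun a b c => c < b ∧ b < a) f) k

/-- the mak-Wilf classes of single length-3 patterns are
`{123}`, `{321}`, `{132,312}`, `{213,231}`, and these four classes are pairwise
distinct. -/
theorem stmt4 :
    (∀ n k, makCount Av132 n k = makCount Av312 n k) ∧
    (∀ n k, makCount Av213 n k = makCount Av231 n k) ∧
    (∃ n k, makCount Av123 n k ≠ makCount Av321 n k) ∧
    (∃ n k, makCount Av123 n k ≠ makCount Av132 n k) ∧
    (∃ n k, makCount Av123 n k ≠ makCount Av213 n k) ∧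
    (∃ n k, makCount Av321 n k ≠ makCount Av132 n k) ∧
    (∃ n k, makCount Av321 n k ≠ makCount Av213 n k) ∧
    (∃ n k, makCount Av132 n k ≠ makCount Av213 n k) := by
  refine ⟨eq1, eq2, ⟨3, 0, ?_⟩, ⟨3, 0, ?_⟩, ⟨3, 0, ?_⟩, ⟨3, 3, ?_⟩, ⟨3, 3, ?_⟩, ⟨3, 1, ?_⟩⟩
  · rw [c123, c321]; decide +kernel
  · rw [c123, c132]; decide +kernel
  · rw [c123, c213]; decide +kernel
  · rw [c321, c132]; decide +kernel
  · rw [c321, c213]; decide +kernel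
  · rw [c132, c213]; decide +kernel

end MahonianStats
end

section
/- For any n ≥ 1, Σ_{σ ∈ S_n(132)} q^{maj(σ)} x^{LRMin(σ)} = Σ_{σ ∈ S_n(132)} q^{BAST6(σ)} x^{LRMin(σ)}, where BAST6 = (-21-3) + (3-21) + des and x^S = Π_{s∈S} x_s. In particular maj and the statistic (21-3)+(3-21)+des are jointly equidistributed with the set of left-to-right minima over 132-avoiding permutations. -/
namespace MahonianStats

open Finset

/-- Set of values of left-to-right minima. -/
def LRMinSet (n : ℕ) (f : ℕ → ℕ) : Finset ℕ :=
  ((Finset.range n).filter fun j => ∀ i < j, f j < f i).image f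

/-- The Mahonian statistic `(21-3) + (3-21) + des`. -/
def bast6 (n : ℕ) (f : ℕ → ℕ) : ℕ := p21_3 n f + p3_21 n f + des n f


structure Good (n : ℕ) (f : ℕ → ℕ) : Prop where
  pos : ∀ i < n, 1 ≤ f i
  le : ∀ i < n, f i ≤ n
  inj : ∀ i < n, ∀ j < n, f i = f j → i = j
  surj : ∀ v, 1 ≤ v → v ≤ n → ∃ i < n, f i = v

lemma good_pf {n : ℕ} (σ : Equiv.Perm (Fin n)) : Good n (pf σ) := by
  refine ⟨?_, ?_, ?_, ?_⟩
  · intro i hi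
    simp [pf, hi]
  · intro i hi
    simp only [pf, hi, dif_pos]
    have := (σ ⟨i, hi⟩).2
    omega
  · intro i hi j hj h
    simp only [pf, hi, hj, dif_pos] at h
    have h2 : σ ⟨i, hi⟩ = σ ⟨j, hj⟩ := Fin.ext (by omega)
    simpa using σ.injective h2
  · intro v h1 h2
    refine ⟨(σ.symm ⟨v - 1, by omega⟩ : Fin n), (σ.symm _).2, ?_⟩
    simp [pf]
    omega

/-- Every good sequence vanishing out of range comes from a permutation. -/
lemma exists_perm {n : ℕ} {f : ℕ → ℕ} (hpos : ∀ i < n, 1 ≤ f i) (hle : ∀ i < n, f i ≤ n)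
    (hinj : ∀ i < n, ∀ j < n, f i = f j → i = j) (h0 : ∀ i, n ≤ i → f i = 0) :
    ∃ σ : Equiv.Perm (Fin n), pf σ = f := by
  let φ : Fin n → Fin n := fun i => ⟨f i - 1, by
    have := hpos i i.2
    have := hle i i.2
    omega⟩
  have hφ : Function.Injective φ := by
    intro a b hab
    have h1 : f a - 1 = f b - 1 := congrArg Fin.val hab
    have := hpos a a.2
    have := hpos b b.2
    exact Fin.ext (hinj a a.2 b b.2 (by omega))
  refine ⟨Equiv.ofBijective φ (Finite.injective_iff_bijective.mp hφ), ?_⟩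
  funext i
  by_cases hi : i < n
  · simp only [pf, hi, dif_pos, Equiv.ofBijective_apply, φ]
    have := hpos i hi
    omega
  · simp [pf, hi, h0 i (by omega)]

def DD (n : ℕ) (f : ℕ → ℕ) : Finset ℕ := (desSet n f).image (fun i => i + 1)
def EE (n : ℕ) (f : ℕ → ℕ) : Finset ℕ := (desSet n f).image (fun i => n + 1 - f i)

lemma mem_desSet {n : ℕ} {f : ℕ → ℕ} {i : ℕ} :
    i ∈ desSet n f ↔ i + 1 < n ∧ f (i + 1) < f i := by
  simp only [desSet, mem_filter, mem_range]
  constructor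
  · rintro ⟨a, b⟩
    exact ⟨by omega, b⟩
  · rintro ⟨a, b⟩
    exact ⟨by omega, b⟩

lemma mem_LR {n : ℕ} {f : ℕ → ℕ} {v : ℕ} :
    v ∈ LRMinSet n f ↔ ∃ j < n, (∀ i < j, f j < f i) ∧ f j = v := by
  simp [LRMinSet, and_assoc]

lemma maj_eq_s6 (n : ℕ) (f : ℕ → ℕ) : maj n f = ∑ x ∈ DD n f, x := by
  rw [DD, sum_image (by intro a _ b _ h; simpa using h)]
  rfl

lemma EE_inj {n : ℕ} {f : ℕ → ℕ} (hf : Good n f) :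
    Set.InjOn (fun i => n + 1 - f i) (desSet n f : Set ℕ) := by
  intro a ha b hb h
  have ha := (mem_desSet.mp ha).1
  have hb := (mem_desSet.mp hb).1
  have h1 := hf.le a (by omega)
  have h2 := hf.le b (by omega)
  simp only at h
  exact hf.inj a (by omega) b (by omega) (by omega)

lemma card_gt {n : ℕ} {f : ℕ → ℕ} (hf : Good n f) (v : ℕ) :
    ((range n).filter fun k => v < f k).card = n - v := by
  have : ((range n).filter fun k => v < f k).image f = Ioc v n := by
    ext w
    simp only [mem_image, mem_filter, mem_range, mem_Ioc]
    constructor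
    · rintro ⟨a, ⟨h1, h2⟩, rfl⟩
      exact ⟨h2, hf.le a h1⟩
    · rintro ⟨h1, h2⟩
      obtain ⟨i, hi, rfl⟩ := hf.surj w (by omega) h2
      exact ⟨i, ⟨hi, h1⟩, rfl⟩
  rw [← Nat.card_Ioc, ← this, card_image_of_injOn]
  intro a ha b hb h
  simp at ha hb
  exact hf.inj a ha.1 b hb.1 h

lemma p21_3_eq (n : ℕ) (f : ℕ → ℕ) :
    p21_3 n f = ∑ i ∈ desSet n f, ((range n).filter fun k => i < k ∧ f i < f k).card := by
  rw [p21_3, card_eq_sum_card_fiberwise (f := Prod.fst) (t := desSet n f)]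
  · refine sum_congr rfl fun i hi => ?_
    refine card_bij (fun p _ => p.2) ?_ ?_ ?_
    · rintro ⟨a, b⟩ h
      simp only [mem_filter, mem_product, mem_range] at h ⊢
      obtain ⟨⟨⟨h1, h2⟩, h3, h4, h5⟩, rfl⟩ := h
      exact ⟨h2, by omega, h5⟩
    · rintro ⟨a, b⟩ h ⟨c, d⟩ h' e
      simp only [mem_filter] at h h'
      simp only at e
      rw [Prod.mk.injEq]
      exact ⟨h.2.trans h'.2.symm, e⟩
    · intro b hb
      simp only [mem_filter, mem_range] at hb
      rw [mem_desSet] at hi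
      refine ⟨(i, b), ?_, rfl⟩
      simp only [mem_filter, mem_product, mem_range]
      have : i + 1 ≠ b := by
        rintro rfl
        omega
      exact ⟨⟨⟨by omega, hb.1⟩, by omega, hi.2, hb.2.2⟩, trivial⟩
  · rintro ⟨a, b⟩ h
    simp only [coe_filter, Set.mem_ofPred_eq, mem_product, mem_range] at h
    exact mem_desSet.mpr ⟨by simp only; omega, h.2.2.1⟩

lemma p3_21_eq (n : ℕ) (f : ℕ → ℕ) :
    p3_21 n f = ∑ i ∈ desSet n f, ((range n).filter fun k => k < i ∧ f i < f k).card := by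
  rw [p3_21, card_eq_sum_card_fiberwise (f := Prod.snd) (t := desSet n f)]
  · refine sum_congr rfl fun i hi => ?_
    refine card_bij (fun p _ => p.1) ?_ ?_ ?_
    · rintro ⟨a, b⟩ h
      simp only [mem_filter, mem_product, mem_range] at h ⊢
      obtain ⟨⟨⟨h1, h2⟩, h3, h4, h5, h6⟩, rfl⟩ := h
      exact ⟨h1, h3, h6⟩
    · rintro ⟨a, b⟩ h ⟨c, d⟩ h' e
      simp only [mem_filter] at h h'
      simp only at e
      rw [Prod.mk.injEq]
      exact ⟨e, h.2.trans h'.2.symm⟩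
    · intro b hb
      simp only [mem_filter, mem_range] at hb
      rw [mem_desSet] at hi
      refine ⟨(b, i), ?_, rfl⟩
      simp only [mem_filter, mem_product, mem_range]
      exact ⟨⟨⟨hb.1, by omega⟩, hb.2.1, hi.1, hi.2, hb.2.2⟩, trivial⟩
  · rintro ⟨a, b⟩ h
    simp only [coe_filter, Set.mem_ofPred_eq, mem_product, mem_range] at h
    exact mem_desSet.mpr ⟨h.2.2.1, h.2.2.2.1⟩

lemma bast6_eq {n : ℕ} {f : ℕ → ℕ} (hf : Good n f) : bast6 n f = ∑ x ∈ EE n f, x := by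
  rw [EE, sum_image (EE_inj hf), bast6, p21_3_eq, p3_21_eq, des, card_eq_sum_ones,
    ← sum_add_distrib, ← sum_add_distrib]
  refine sum_congr rfl fun i hi => ?_
  rw [mem_desSet] at hi
  have h1 := hf.le i (by omega)
  have h2 := card_gt hf (f i)
  rw [← card_union_of_disjoint]
  · have : ((range n).filter fun k => i < k ∧ f i < f k) ∪
        ((range n).filter fun k => k < i ∧ f i < f k) =
        (range n).filter fun k => f i < f k := by
      ext k
      simp only [mem_union, mem_filter, mem_range]
      constructor
      · tauto
      · rintro ⟨a, b⟩
        have : k ≠ i := by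
          rintro rfl
          omega
        rcases lt_or_gt_of_ne this with h | h <;> tauto
    rw [this, h2]
    omega
  · rw [disjoint_left]
    intro k hk hk'
    simp only [mem_filter] at hk hk'
    omega

/-- In a 132-avoiding sequence descent bottoms are left-to-right minima. -/
lemma bottom_LR {n : ℕ} {f : ℕ → ℕ} (hf : Good n f) (ha : Av132 n f) {i : ℕ}
    (hi : i + 1 < n) (hd : f (i + 1) < f i) : ∀ j < i + 1, f (i + 1) < f j := by
  intro j hj
  by_contra hc
  have hne : f j ≠ f (i + 1) := fun h => by
    have := hf.inj j (by omega) (i + 1) hi h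
    omega
  have : j ≠ i := by
    rintro rfl
    omega
  exact ha ⟨j, i, i + 1, by omega, by omega, hi, by omega, hd⟩

lemma E_step_le {n : ℕ} {f g : ℕ → ℕ} (hf : Good n f) (hg : Good n g)
    (hag : Av132 n g) (hS : LRMinSet n f = LRMinSet n g)
    (i : ℕ) (hi : i + 1 < n) (ih : ∀ j ≤ i, f j = g j)
    (haf : Av132 n f)
    (hd : f (i + 1) < f i ↔ g (i + 1) < g i) : ¬ f (i + 1) < g (i + 1) := by
  intro hlt
  by_cases h : f (i + 1) < f i
  · have hgd := hd.mp h
    have hm : g (i + 1) ∈ LRMinSet n f := by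
      rw [hS, mem_LR]
      exact ⟨i + 1, hi, bottom_LR hg hag hi hgd, rfl⟩
    obtain ⟨j, hj, hmin, he⟩ := mem_LR.mp hm
    rcases lt_trichotomy j (i + 1) with h1 | h1 | h1
    · rw [ih j (by omega)] at he
      have := hg.inj j hj (i + 1) hi he
      omega
    · subst h1
      omega
    · have := hmin (i + 1) h1
      omega
  · have hfi : f i ≠ f (i + 1) := fun h => by
      have := hf.inj i (by omega) (i + 1) hi h
      omega
    obtain ⟨k, hk, he⟩ := hg.surj (f (i + 1)) (hf.pos _ hi) (hf.le _ hi)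
    rcases lt_trichotomy k (i + 1) with h1 | h1 | h1
    · rw [← ih k (by omega)] at he
      have := hf.inj k hk (i + 1) hi he
      omega
    · subst h1
      omega
    · have := ih i le_rfl
      exact hag ⟨i, i + 1, k, by omega, h1, hk, by omega, by omega⟩

lemma E_des {n : ℕ} {f g : ℕ → ℕ} (hf : Good n f) (hg : Good n g) (hE : EE n f = EE n g)
    (i : ℕ) (hi : i + 1 < n) (he : f i = g i) (h : f (i + 1) < f i) : g (i + 1) < g i := by
  have h1 : n + 1 - f i ∈ EE n g := by
    rw [← hE]
    exact mem_image.mpr ⟨i, mem_desSet.mpr ⟨hi, h⟩, rfl⟩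
  obtain ⟨j, hj, hj2⟩ := mem_image.mp h1
  rw [mem_desSet] at hj
  have a1 := hf.le i (by omega)
  have a2 := hg.le j (by omega)
  have := hg.inj j (by omega) i (by omega) (by omega)
  subst this
  exact hj.2

lemma first_le {n : ℕ} {f g : ℕ → ℕ} (hn : 1 ≤ n) (hS : LRMinSet n f = LRMinSet n g) :
    f 0 ≤ g 0 := by
  have : f 0 ∈ LRMinSet n g := by
    rw [← hS, mem_LR]
    exact ⟨0, hn, by simp, rfl⟩
  obtain ⟨j, hj, h1, h2⟩ := mem_LR.mp this
  rcases Nat.eq_zero_or_pos j with h | h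
  · subst h
    omega
  · have := h1 0 h
    omega

lemma E_inj {n : ℕ} {f g : ℕ → ℕ} (hn : 1 ≤ n) (hf : Good n f) (hg : Good n g)
    (haf : Av132 n f) (hag : Av132 n g)
    (hS : LRMinSet n f = LRMinSet n g) (hE : EE n f = EE n g) : ∀ i < n, f i = g i := by
  intro i
  induction i using Nat.strong_induction_on with
  | _ i ih =>
    intro hi
    rcases i with _ | i
    · exact le_antisymm (first_le hn hS) (first_le hn hS.symm)
    · have ih' : ∀ j ≤ i, f j = g j := fun j hj => ih j (by omega) (by omega)
      have hd : f (i + 1) < f i ↔ g (i + 1) < g i :=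
        ⟨E_des hf hg hE i hi (ih' i le_rfl), E_des hg hf hE.symm i hi (ih' i le_rfl).symm⟩
      have h1 := E_step_le hf hg hag hS i hi ih' haf hd
      have h2 := E_step_le hg hf haf hS.symm i hi (fun j hj => (ih' j hj).symm) hag hd.symm
      omega

/-- The common range of the two encodings. -/
structure InX (n : ℕ) (S Q : Finset ℕ) : Prop where
  sub : ∀ s ∈ S, 1 ≤ s ∧ s ≤ n
  ne : S.Nonempty
  qsub : ∀ q ∈ Q, 1 ≤ q ∧ q < n
  card : Q.card + 1 ≤ S.card
  cond : ∀ t < n, (S.filter fun s => n + 1 - t ≤ s).card ≤ (Q.filter fun q => q ≤ t).card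
  one : 1 ∈ S

lemma walk {f : ℕ → ℕ} (v : ℕ) (n : ℕ) (hinj : ∀ i < n, ∀ j < n, f i = f j → i = j)
    (i : ℕ) (hi : i < n) :
    ((range (i + 1)).filter fun j => (∀ k < j, f j < f k) ∧ v ≤ f j).card ≤
    ((range i).filter fun j => f (j + 1) < f j ∧ v ≤ f j).card + (if v ≤ f i then 1 else 0) := by
  induction i with
  | zero =>
    by_cases h : v ≤ f 0 <;> simp [range_one, filter_singleton, h]
  | succ i ih =>
    have ih := ih (by omega)
    have hne : f i ≠ f (i + 1) := fun h => by
      have := hinj i (by omega) (i + 1) hi h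
      omega
    rw [range_add_one (n := i + 1), filter_insert]
    conv_rhs => rw [range_add_one, filter_insert]
    by_cases h1 : (∀ k < i + 1, f (i + 1) < f k) ∧ v ≤ f (i + 1)
    · have h2 : f (i + 1) < f i ∧ v ≤ f i := ⟨h1.1 i (by omega), by
        have := h1.1 i (by omega)
        omega⟩
      rw [if_pos h1, if_pos h2, if_pos h1.2, card_insert_of_notMem (by simp),
        card_insert_of_notMem (by simp)]
      rw [if_pos h2.2] at ih
      omega
    · rw [if_neg h1]
      by_cases h2 : f (i + 1) < f i ∧ v ≤ f i
      · rw [if_pos h2, card_insert_of_notMem (by simp)]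
        rw [if_pos h2.2] at ih
        omega
      · rw [if_neg h2]
        refine ih.trans ?_
        split_ifs <;> omega

lemma E_mem {n : ℕ} {f : ℕ → ℕ} (hn : 1 ≤ n) (hf : Good n f) (ha : Av132 n f) :
    InX n (LRMinSet n f) (EE n f) := by
  obtain ⟨i0, hi0, hi01⟩ := hf.surj 1 le_rfl hn
  have hone : 1 ∈ LRMinSet n f := by
    rw [mem_LR]
    refine ⟨i0, hi0, ?_, hi01⟩
    intro i hi
    have := hf.pos i (by omega)
    have h2 : f i ≠ f i0 := fun h => by
      have := hf.inj i (by omega) i0 hi0 h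
      omega
    omega
  refine ⟨?_, ⟨1, hone⟩, ?_, ?_, ?_, hone⟩
  · intro s hs
    obtain ⟨j, hj, -, rfl⟩ := mem_LR.mp hs
    exact ⟨hf.pos j hj, hf.le j hj⟩
  · intro q hq
    obtain ⟨i, hi, rfl⟩ := mem_image.mp hq
    rw [mem_desSet] at hi
    have := hf.pos (i + 1) hi.1
    have := hf.le i (by omega)
    omega
  · rw [EE, card_image_of_injOn (EE_inj hf)]
    have hsub : insert (f 0) ((desSet n f).image fun i => f (i + 1)) ⊆ LRMinSet n f := by
      intro x hx
      rw [mem_insert] at hx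
      rcases hx with rfl | hx
      · exact mem_LR.mpr ⟨0, hn, by simp, rfl⟩
      · obtain ⟨i, hi, rfl⟩ := mem_image.mp hx
        rw [mem_desSet] at hi
        exact mem_LR.mpr ⟨i + 1, hi.1, bottom_LR hf ha hi.1 hi.2, rfl⟩
    have := card_le_card hsub
    rw [card_insert_of_notMem, card_image_of_injOn] at this
    · exact this
    · intro a ha b hb h
      have ha := (mem_desSet.mp ha).1
      have hb := (mem_desSet.mp hb).1
      have := hf.inj _ ha _ hb h
      omega
    · intro h
      obtain ⟨i, hi, h⟩ := mem_image.mp h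
      have := hf.inj _ (mem_desSet.mp hi).1 0 hn h
      omega
  · intro t ht
    have hL : (LRMinSet n f).filter (fun s => n + 1 - t ≤ s) ⊆
        ((range (i0 + 1)).filter fun j => (∀ k < j, f j < f k) ∧ n + 1 - t ≤ f j).image f := by
      intro s hs
      rw [mem_filter] at hs
      obtain ⟨hs, hs2⟩ := hs
      obtain ⟨j, hj, hm, rfl⟩ := mem_LR.mp hs
      refine mem_image.mpr ⟨j, ?_, rfl⟩
      rw [mem_filter, mem_range]
      refine ⟨?_, hm, hs2⟩
      by_contra hc
      have := hm i0 (by omega)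
      have := hf.pos j hj
      omega
    have hR : ((range i0).filter fun j => f (j + 1) < f j ∧ n + 1 - t ≤ f j).image
        (fun i => n + 1 - f i) ⊆ (EE n f).filter fun q => q ≤ t := by
      intro q hq
      obtain ⟨j, hj, rfl⟩ := mem_image.mp hq
      simp only [mem_filter, mem_range] at hj
      rw [mem_filter]
      exact ⟨mem_image.mpr ⟨j, mem_desSet.mpr ⟨by omega, hj.2.1⟩, rfl⟩, by omega⟩
    have hR' := card_le_card hR
    rw [card_image_of_injOn] at hR'
    · have hw := walk (n + 1 - t) n hf.inj i0 hi0
      rw [if_neg (by omega)] at hw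
      exact ((card_le_card hL).trans card_image_le).trans (hw.trans hR')
    · intro a ha b hb h
      simp only [coe_filter, mem_range, Set.mem_ofPred_eq] at ha hb
      exact EE_inj hf (mem_desSet.mpr ⟨by omega, ha.2.1⟩) (mem_desSet.mpr ⟨by omega, hb.2.1⟩) h

/-! The greedy construction. -/

/-- current minimum -/
def mm (S Q : Finset ℕ) : ℕ → ℕ
  | 0 => S.sup id
  | i + 1 => if i + 1 ∈ Q then (S.filter fun s => s < mm S Q i).sup id else mm S Q i

/-- next available value -/
noncomputable def nx (S : Finset ℕ) (m : ℕ) (U : Finset ℕ) : ℕ :=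
  sInf {v | m < v ∧ v ∉ S ∧ v ∉ U}

/-- used values outside `S` -/
noncomputable def uu (S Q : Finset ℕ) : ℕ → Finset ℕ
  | 0 => ∅
  | i + 1 => if i + 1 ∈ Q then uu S Q i else insert (nx S (mm S Q i) (uu S Q i)) (uu S Q i)

noncomputable def gf (S Q : Finset ℕ) : ℕ → ℕ
  | 0 => mm S Q 0
  | i + 1 => if i + 1 ∈ Q then mm S Q (i + 1) else nx S (mm S Q i) (uu S Q i)

lemma nx_spec (S : Finset ℕ) (m : ℕ) (U : Finset ℕ) :
    m < nx S m U ∧ nx S m U ∉ S ∧ nx S m U ∉ U := by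
  have hne : {v | m < v ∧ v ∉ S ∧ v ∉ U}.Nonempty := by
    refine ⟨m + S.sup id + U.sup id + 1, by omega, ?_, ?_⟩
    · intro h
      have := le_sup (f := id) h
      simp only [id] at this
      omega
    · intro h
      have := le_sup (f := id) h
      simp only [id] at this
      omega
  exact Nat.sInf_mem hne

lemma nx_le {S : Finset ℕ} {m : ℕ} {U : Finset ℕ} {v : ℕ} (h1 : m < v) (h2 : v ∉ S)
    (h3 : v ∉ U) : nx S m U ≤ v := Nat.sInf_le ⟨h1, h2, h3⟩

lemma sup_mem_self {S : Finset ℕ} (h : S.Nonempty) : S.sup id ∈ S := by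
  obtain ⟨i, hi, he⟩ := exists_mem_eq_sup S h id
  rw [he]
  exact hi

/-- number of descents so far -/
lemma cq_succ (Q : Finset ℕ) (i : ℕ) : (Q.filter fun q => q ≤ i + 1).card =
    (Q.filter fun q => q ≤ i).card + if i + 1 ∈ Q then 1 else 0 := by
  by_cases h : i + 1 ∈ Q
  · rw [if_pos h]
    have : (Q.filter fun q => q ≤ i + 1) = insert (i + 1) (Q.filter fun q => q ≤ i) := by
      ext x
      simp only [mem_filter, mem_insert]
      constructor
      · rintro ⟨a, b⟩
        by_cases hx : x = i + 1
        · exact Or.inl hx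
        · exact Or.inr ⟨a, by omega⟩
      · rintro (rfl | ⟨a, b⟩)
        · exact ⟨h, le_rfl⟩
        · exact ⟨a, by omega⟩
    rw [this, card_insert_of_notMem (by simp)]
  · rw [if_neg h, add_zero]
    congr 1
    ext x
    simp only [mem_filter]
    refine and_congr_right fun hx => ?_
    have : x ≠ i + 1 := by
      rintro rfl
      exact h hx
    omega

section construction
variable {n : ℕ} {S Q : Finset ℕ}

lemma below_ne (hX : InX n S Q) {i : ℕ}
    (h2 : (S.filter fun s => mm S Q i ≤ s).card = (Q.filter fun q => q ≤ i).card + 1)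
    (hq : i + 1 ∈ Q) : (S.filter fun s => s < mm S Q i).Nonempty := by
  rw [nonempty_iff_ne_empty]
  intro he
  have h3 : (S.filter fun s => mm S Q i ≤ s) = S := by
    rw [filter_eq_self]
    intro x hx
    by_contra hc
    have : x ∈ (S.filter fun s => s < mm S Q i) := mem_filter.mpr ⟨hx, by omega⟩
    rw [he] at this
    simp at this
  rw [h3] at h2
  have h4 := cq_succ Q i
  rw [if_pos hq] at h4
  have h5 := card_filter_le Q (fun q => q ≤ i + 1)
  have := hX.card
  omega

lemma mm_step (hX : InX n S Q) {i : ℕ}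
    (h2 : (S.filter fun s => mm S Q i ≤ s).card = (Q.filter fun q => q ≤ i).card + 1)
    (hq : i + 1 ∈ Q) : mm S Q (i + 1) ∈ S ∧ mm S Q (i + 1) < mm S Q i ∧
      ∀ s ∈ S, s < mm S Q i → s ≤ mm S Q (i + 1) := by
  have h := sup_mem_self (below_ne hX h2 hq)
  rw [mm, if_pos hq]
  rw [mem_filter] at h
  refine ⟨h.1, h.2, fun s hs hs2 => ?_⟩
  exact le_sup (f := id) (mem_filter.mpr ⟨hs, hs2⟩)

lemma mm_aux (hX : InX n S Q) {i : ℕ} 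
    (h2 : (S.filter fun s => mm S Q i ≤ s).card = (Q.filter fun q => q ≤ i).card + 1)
    (hq : i + 1 ∈ Q) : mm S Q (i + 1) ∈ S ∧ (S.filter fun s => mm S Q (i + 1) ≤ s).card =
      (S.filter fun s => mm S Q i ≤ s).card + 1 := by
  obtain ⟨a, b, c⟩ := mm_step hX h2 hq
  refine ⟨a, ?_⟩
  have : (S.filter fun s => mm S Q (i + 1) ≤ s) =
      insert (mm S Q (i + 1)) (S.filter fun s => mm S Q i ≤ s) := by
    ext x
    simp only [mem_filter, mem_insert]
    constructor
    · rintro ⟨h, h'⟩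
      by_cases hx : x < mm S Q i
      · exact Or.inl (le_antisymm (c x h hx) h')
      · exact Or.inr ⟨h, by omega⟩
    · rintro (rfl | ⟨h, h'⟩)
      · exact ⟨a, le_rfl⟩
      · exact ⟨h, by omega⟩
  rw [this, card_insert_of_notMem]
  intro h
  rw [mem_filter] at h
  omega

lemma mm_inv' (hX : InX n S Q) (i : ℕ) : mm S Q i ∈ S ∧
    (S.filter fun s => mm S Q i ≤ s).card = (Q.filter fun q => q ≤ i).card + 1 := by
  induction i with
  | zero =>
    have h0 : mm S Q 0 ∈ S := sup_mem_self hX.ne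
    have h1 : (Q.filter fun q => q ≤ 0) = ∅ := by
      rw [filter_eq_empty_iff]
      intro q hq
      have := hX.qsub q hq
      omega
    have h2 : (S.filter fun s => mm S Q 0 ≤ s) = {mm S Q 0} := by
      ext x
      simp only [mem_filter, mem_singleton]
      constructor
      · rintro ⟨a, b⟩
        exact le_antisymm (le_sup (f := id) a) b
      · rintro rfl
        exact ⟨h0, le_rfl⟩
    refine ⟨h0, ?_⟩
    rw [h1, h2]
    simp
  | succ i ih =>
    obtain ⟨h1, h2⟩ := ih
    rw [cq_succ]
    by_cases hq : i + 1 ∈ Q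
    · obtain ⟨h4, h5⟩ := mm_aux hX h2 hq
      refine ⟨h4, ?_⟩
      rw [if_pos hq, h5, h2]
    · rw [if_neg hq, mm, if_neg hq]
      exact ⟨h1, h2⟩

lemma mm_inv (hX : InX n S Q) (i : ℕ) : mm S Q i ∈ S ∧
    (S.filter fun s => mm S Q i ≤ s).card = (Q.filter fun q => q ≤ i).card + 1 ∧
    (i + 1 ∈ Q → mm S Q (i + 1) < mm S Q i) :=
  ⟨(mm_inv' hX i).1, (mm_inv' hX i).2, fun hq => (mm_step hX (mm_inv' hX i).2 hq).2.1⟩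

lemma mm_anti (hX : InX n S Q) {i j : ℕ} (h : i ≤ j) : mm S Q j ≤ mm S Q i := by
  induction j, h using Nat.le_induction with
  | base => exact le_rfl
  | succ j hj ih =>
    refine le_trans ?_ ih
    by_cases hq : j + 1 ∈ Q
    · exact ((mm_inv hX j).2.2 hq).le
    · rw [mm, if_neg hq]

lemma mm_lt (hX : InX n S Q) {i j : ℕ} (h : i < j) (hj : j ∈ Q) : mm S Q j < mm S Q i := by
  obtain ⟨j, rfl⟩ : ∃ k, j = k + 1 := ⟨j - 1, by omega⟩
  exact ((mm_inv hX j).2.2 hj).trans_le (mm_anti hX (by omega))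

lemma mm_bound (hX : InX n S Q) {i : ℕ} (hi : i < n) : mm S Q i + i ≤ n := by
  by_contra hc
  obtain ⟨h1, h2, -⟩ := mm_inv hX i
  have h3 := hX.cond i hi
  have h4 : (S.filter fun s => mm S Q i ≤ s).card ≤ (S.filter fun s => n + 1 - i ≤ s).card := by
    apply card_le_card
    intro x hx
    rw [mem_filter] at hx ⊢
    exact ⟨hx.1, by omega⟩
  omega

lemma uu_card (i : ℕ) : (uu S Q i).card + (Q.filter fun q => q ≤ i).card ≤
    i + (Q.filter fun q => q ≤ 0).card := by
  induction i with
  | zero => simp [uu]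
  | succ i ih =>
    rw [cq_succ, uu]
    by_cases hq : i + 1 ∈ Q
    · rw [if_pos hq, if_pos hq]
      omega
    · rw [if_neg hq, if_neg hq]
      have := card_insert_le (nx S (mm S Q i) (uu S Q i)) (uu S Q i)
      omega

lemma uu_mono {i j : ℕ} (h : i ≤ j) : uu S Q i ⊆ uu S Q j := by
  induction j, h using Nat.le_induction with
  | base => exact Subset.rfl
  | succ j hj ih =>
    refine ih.trans ?_
    rw [uu]
    split_ifs
    · exact Subset.rfl
    · exact subset_insert _ _

lemma gf_S {i : ℕ} (h : i = 0 ∨ i ∈ Q) : gf S Q i = mm S Q i := by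
  rcases i with _ | i
  · rfl
  · have : i + 1 ∈ Q := by simpa using h
    rw [gf, if_pos this]

lemma gf_N {i : ℕ} (h : i + 1 ∉ Q) : gf S Q (i + 1) = nx S (mm S Q i) (uu S Q i) := by
  rw [gf, if_neg h]

lemma gf_mem_uu {i : ℕ} (h0 : i ≠ 0) (h : i ∉ Q) : gf S Q i ∈ uu S Q i := by
  obtain ⟨i, rfl⟩ : ∃ k, i = k + 1 := ⟨i - 1, by omega⟩
  rw [gf_N h, uu, if_neg h]
  exact mem_insert_self _ _

lemma mm_le_gf (i : ℕ) : mm S Q i ≤ gf S Q i := by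
  by_cases h : i = 0 ∨ i ∈ Q
  · rw [gf_S h]
  · push Not at h
    obtain ⟨i, rfl⟩ : ∃ k, i = k + 1 := ⟨i - 1, by omega⟩
    rw [gf_N h.2, mm, if_neg h.2]
    exact (nx_spec S _ _).1.le

lemma gf_N_gt {i : ℕ} (h0 : i ≠ 0) (h : i ∉ Q) :
    mm S Q i < gf S Q i ∧ gf S Q i ∉ S := by
  obtain ⟨i, rfl⟩ : ∃ k, i = k + 1 := ⟨i - 1, by omega⟩
  rw [gf_N h, mm, if_neg h]
  exact ⟨(nx_spec S _ _).1, (nx_spec S _ _).2.1⟩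

lemma gf_ne (hX : InX n S Q) {i j : ℕ} (hij : i < j) : gf S Q i ≠ gf S Q j := by
  intro he
  by_cases hj : j ∈ Q
  · rw [gf_S (Or.inr hj)] at he
    by_cases hi : i = 0 ∨ i ∈ Q
    · rw [gf_S hi] at he
      have := mm_lt hX hij hj
      omega
    · push Not at hi
      apply (gf_N_gt (S := S) hi.1 hi.2).2
      rw [he]
      exact (mm_inv hX j).1
  · have hj2 := (gf_N_gt (S := S) (i := j) (by omega) hj).2
    by_cases hi : i = 0 ∨ i ∈ Q
    · rw [gf_S hi] at he
      rw [← he] at hj2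
      exact hj2 (mm_inv hX i).1
    · push Not at hi
      have h1 := gf_mem_uu (S := S) hi.1 hi.2
      obtain ⟨j, rfl⟩ : ∃ k, j = k + 1 := ⟨j - 1, by omega⟩
      have h2 := uu_mono (S := S) (Q := Q) (show i ≤ j by omega) h1
      rw [he, gf_N hj] at h2
      exact (nx_spec S _ _).2.2 h2

lemma gf_le (hX : InX n S Q) {i : ℕ} (hi : i < n) : gf S Q i ≤ n := by
  by_cases h : i = 0 ∨ i ∈ Q
  · rw [gf_S h]
    exact (hX.sub _ (mm_inv hX i).1).2
  · push Not at h
    obtain ⟨h0, h⟩ := h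
    obtain ⟨i, rfl⟩ : ∃ k, i = k + 1 := ⟨i - 1, by omega⟩
    rw [gf_N h]
    have hb := mm_bound hX hi
    rw [mm, if_neg h] at hb
    obtain ⟨h1, h2, -⟩ := mm_inv hX i
    have h3 := uu_card (S := S) (Q := Q) i
    have h4 : (Q.filter fun q => q ≤ 0) = ∅ := by
      rw [filter_eq_empty_iff]
      intro q hq
      have := hX.qsub q hq
      omega
    rw [h4, card_empty] at h3
    have h5 := card_union_le (S.filter fun s => mm S Q i ≤ s) (uu S Q i)
    have h6 : ((S.filter fun s => mm S Q i ≤ s) ∪ uu S Q i).card < (Icc (mm S Q i) n).card := by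
      rw [Nat.card_Icc]
      omega
    obtain ⟨v, hv, hv2⟩ := exists_mem_notMem_of_card_lt_card h6
    rw [mem_Icc] at hv
    rw [mem_union, mem_filter] at hv2
    push Not at hv2
    have hvS : v ∉ S := fun hs => by
      have := hv2.1 hs
      omega
    have : mm S Q i ≠ v := by
      rintro rfl
      exact hvS h1
    exact (nx_le (by omega) hvS hv2.2).trans hv.2

lemma gf_attain (i : ℕ) : ∃ j ≤ i, gf S Q j = mm S Q i := by
  induction i with
  | zero => exact ⟨0, le_rfl, rfl⟩
  | succ i ih =>
    by_cases h : i + 1 ∈ Q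
    · exact ⟨i + 1, le_rfl, gf_S (Or.inr h)⟩
    · rw [mm, if_neg h]
      obtain ⟨j, hj, he⟩ := ih
      exact ⟨j, by omega, he⟩

lemma gf_LR (hX : InX n S Q) (j : ℕ) :
    (∀ i < j, gf S Q j < gf S Q i) ↔ (j = 0 ∨ j ∈ Q) := by
  constructor
  · intro h
    by_contra hc
    push Not at hc
    have h1 := (gf_N_gt (S := S) hc.1 hc.2).1
    obtain ⟨i, hi, he⟩ := gf_attain (S := S) (Q := Q) j
    have : i ≠ j := by
      rintro rfl
      omega
    have := h i (by omega)
    omega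
  · rintro (rfl | h) i hi
    · omega
    · rw [gf_S (Or.inr h)]
      exact (mm_lt hX hi h).trans_le (mm_le_gf i)

/-- greedy minimality -/
lemma gf_min (hX : InX n S Q) {j k : ℕ} (hj0 : j ≠ 0) (hj : j ∉ Q) (hk : k ∉ Q) (hjk : j < k)
    (h : mm S Q j < gf S Q k) : gf S Q j ≤ gf S Q k := by
  obtain ⟨j, rfl⟩ : ∃ a, j = a + 1 := ⟨j - 1, by omega⟩
  rw [mm, if_neg hj] at h
  rw [gf_N hj]
  refine nx_le h (gf_N_gt (by omega) hk).2 ?_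
  intro hm
  obtain ⟨k, rfl⟩ : ∃ a, k = a + 1 := ⟨k - 1, by omega⟩
  have h2 := uu_mono (S := S) (Q := Q) (show j ≤ k by omega) hm
  rw [gf_N hk] at h2
  exact (nx_spec S _ _).2.2 h2

lemma gf_av (hX : InX n S Q) {i j k : ℕ} (hij : i < j) (hjk : j < k)
    (h1 : gf S Q i < gf S Q k) (h2 : gf S Q k < gf S Q j) : False := by
  have hj : ¬ (j = 0 ∨ j ∈ Q) := by
    rw [← gf_LR hX]
    intro h
    have := h i hij
    omega
  have hk : ¬ (k = 0 ∨ k ∈ Q) := by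
    rw [← gf_LR hX]
    intro h
    have := h i (by omega)
    omega
  push Not at hj hk
  have h3 := mm_anti hX hij.le
  have h4 := mm_le_gf (S := S) (Q := Q) i
  have := gf_min hX hj.1 hj.2 hk.2 hjk (by omega)
  omega

lemma gf_des (hX : InX n S Q) (i : ℕ) : gf S Q (i + 1) < gf S Q i ↔ i + 1 ∈ Q := by
  constructor
  · intro h
    by_contra hc
    have h1 := (gf_N_gt (S := S) (i := i + 1) (by omega) hc).1
    have h2 : mm S Q (i + 1) = mm S Q i := by rw [mm, if_neg hc]
    by_cases hi : i = 0 ∨ i ∈ Q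
    · rw [gf_S hi] at h
      omega
    · push Not at hi
      have := gf_min hX hi.1 hi.2 hc (by omega) (by omega)
      omega
  · intro h
    exact (gf_LR hX (i + 1)).mpr (Or.inr h) i (by omega)

lemma D_surj (hn : 1 ≤ n) (hX : InX n S Q) : ∃ σ : Equiv.Perm (Fin n),
    Av132 n (pf σ) ∧ LRMinSet n (pf σ) = S ∧ DD n (pf σ) = Q := by
  obtain ⟨σ, hσ⟩ := exists_perm (n := n) (f := fun i => if i < n then gf S Q i else 0)
    (by
      intro i hi
      simp only [hi, if_true]
      exact (hX.sub _ (mm_inv hX i).1).1.trans (mm_le_gf i))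
    (by
      intro i hi
      simp only [hi, if_true]
      exact gf_le hX hi)
    (by
      intro i hi j hj h
      simp only [hi, hj, if_true] at h
      rcases lt_trichotomy i j with h1 | h1 | h1
      · exact absurd h (gf_ne hX h1)
      · exact h1
      · exact absurd h.symm (gf_ne hX h1))
    (by
      intro i hi
      simp [Nat.not_lt.mpr hi])
  have hv : ∀ i < n, pf σ i = gf S Q i := by
    intro i hi
    rw [hσ]
    simp [hi]
  refine ⟨σ, ?_, ?_, ?_⟩
  · rintro ⟨i, j, k, hij, hjk, hk, h1, h2⟩
    rw [hv i (by omega), hv k hk] at h1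
    rw [hv j (by omega), hv k hk] at h2
    exact gf_av hX hij hjk h1 h2
  · have hL : LRMinSet n (pf σ) = (insert 0 Q).image (mm S Q) := by
      ext v
      rw [mem_LR, mem_image]
      constructor
      · rintro ⟨j, hj, h1, h2⟩
        have h3 : j = 0 ∨ j ∈ Q := by
          rw [← gf_LR hX]
          intro i hi
          rw [← hv i (by omega), ← hv j hj]
          exact h1 i hi
        refine ⟨j, by rw [mem_insert]; exact h3, ?_⟩
        rw [← h2, hv j hj, gf_S h3]
      · rintro ⟨j, h3, h2⟩
        rw [mem_insert] at h3
        have hj : j < n := by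
          rcases h3 with rfl | h
          · omega
          · exact (hX.qsub j h).2
        refine ⟨j, hj, ?_, ?_⟩
        · intro i hi
          rw [hv i (by omega), hv j hj]
          exact (gf_LR hX j).mpr h3 i hi
        · rw [hv j hj, gf_S h3, h2]
    rw [hL]
    apply eq_of_subset_of_card_le
    · intro v hv
      obtain ⟨j, -, rfl⟩ := mem_image.mp hv
      exact (mm_inv hX j).1
    · have h0 : (0 : ℕ) ∉ Q := fun h => by
        have := hX.qsub 0 h
        omega
      rw [card_image_of_injOn, card_insert_of_notMem h0]
      · have h1 := hX.cond (n - 1) (by omega)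
        have h2 := card_filter_le Q (fun q => q ≤ n - 1)
        have h3 : S.erase 1 ⊆ S.filter fun s => n + 1 - (n - 1) ≤ s := by
          intro s hs
          rw [mem_erase] at hs
          have := hX.sub s hs.2
          exact mem_filter.mpr ⟨hs.2, by omega⟩
        have h4 := card_le_card h3
        rw [card_erase_of_mem hX.one] at h4
        omega
      · have key : ∀ a b, a < b → b ∈ insert 0 Q → mm S Q a ≠ mm S Q b := by
          intro a b hab hb
          rw [mem_insert] at hb
          have := mm_lt hX hab (by
            rcases hb with h | h
            · omega
            · exact h)
          omega
        intro a ha b hb h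
        rcases lt_trichotomy a b with h1 | h1 | h1
        · exact absurd h (key a b h1 hb)
        · exact h1
        · exact absurd h.symm (key b a h1 ha)
  · ext q
    rw [DD, mem_image]
    constructor
    · rintro ⟨i, hi, rfl⟩
      rw [mem_desSet] at hi
      have hi1 := hi.1
      rw [hv (i + 1) hi1, hv i (by omega)] at hi
      exact (gf_des hX i).mp hi.2
    · intro hq
      have := hX.qsub q hq
      refine ⟨q - 1, ?_, by omega⟩
      have h1 : q - 1 + 1 = q := by omega
      rw [mem_desSet, hv (q - 1 + 1) (by omega), hv (q - 1) (by omega)]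
      refine ⟨by omega, (gf_des hX (q - 1)).mpr ?_⟩
      rw [h1]
      exact hq

end construction

lemma two_codes {α β : Type*} [Finite α] {A : Set α} {X : Set β} {D E : α → β}
    (hE : Set.InjOn E A) (hEX : ∀ a ∈ A, E a ∈ X) (hD : X ⊆ D '' A) (p : β → Prop) :
    {a | a ∈ A ∧ p (D a)}.ncard = {a | a ∈ A ∧ p (E a)}.ncard := by
  have hA : A.Finite := Set.toFinite A
  have hDA : (D '' A).Finite := hA.image D
  have hXf : X.Finite := hDA.subset hD
  have h1 : (E '' A).ncard = A.ncard := hE.ncard_image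
  have hsub : E '' A ⊆ X := by
    rintro _ ⟨a, ha, rfl⟩
    exact hEX a ha
  have h2 := Set.ncard_le_ncard hsub hXf
  have h3 := Set.ncard_le_ncard hD hDA
  have h4 : (D '' A).ncard ≤ A.ncard := Set.ncard_image_le hA
  have h5 : E '' A = X := Set.eq_of_subset_of_ncard_le hsub (by omega) hXf
  have h6 : X = D '' A := Set.eq_of_subset_of_ncard_le hD (by omega) hDA
  have hDi : Set.InjOn D A := Set.injOn_of_ncard_image_eq (by omega) hA
  have hs1 : {a | a ∈ A ∧ p (D a)} ⊆ A := fun a ha => ha.1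
  have hs2 : {a | a ∈ A ∧ p (E a)} ⊆ A := fun a ha => ha.1
  rw [← (hDi.mono hs1).ncard_image, ← (hE.mono hs2).ncard_image]
  have img : ∀ F : α → β, F '' {a | a ∈ A ∧ p (F a)} = {x | x ∈ F '' A ∧ p x} := by
    intro F
    ext x
    constructor
    · rintro ⟨a, ⟨h, h'⟩, rfl⟩
      exact ⟨⟨a, h, rfl⟩, h'⟩
    · rintro ⟨⟨a, h, rfl⟩, h'⟩
      exact ⟨a, ⟨h, h'⟩, rfl⟩
  rw [img, img, h5, h6]

/-- over `S_n(132)`, `maj` and `(21-3)+(3-21)+des` are jointly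
equidistributed with the set of left-to-right minima. -/
theorem stmt6 (n : ℕ) (hn : 1 ≤ n) (k : ℕ) (S : Finset ℕ) :
    Set.ncard {σ : Equiv.Perm (Fin n) |
        Av132 n (pf σ) ∧ maj n (pf σ) = k ∧ LRMinSet n (pf σ) = S} =
    Set.ncard {σ : Equiv.Perm (Fin n) |
        Av132 n (pf σ) ∧ bast6 n (pf σ) = k ∧ LRMinSet n (pf σ) = S} := by
  have key := two_codes (A := {σ : Equiv.Perm (Fin n) | Av132 n (pf σ)})
    (X := {x : Finset ℕ × Finset ℕ | InX n x.1 x.2})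
    (D := fun σ => (LRMinSet n (pf σ), DD n (pf σ)))
    (E := fun σ => (LRMinSet n (pf σ), EE n (pf σ)))
    (by
      intro σ hσ τ hτ h
      simp only [Prod.mk.injEq] at h
      have h2 := E_inj hn (good_pf σ) (good_pf τ) hσ hτ h.1 h.2
      ext i
      have h3 := h2 i i.2
      simpa [pf] using h3)
    (fun σ hσ => E_mem hn (good_pf σ) hσ)
    (by
      rintro ⟨S, Q⟩ hx
      obtain ⟨σ, h1, h2, h3⟩ := D_surj hn hx
      exact ⟨σ, h1, by simp [h2, h3]⟩)
    (fun x => ∑ y ∈ x.2, y = k ∧ x.1 = S)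
  simp only [Set.mem_ofPred_eq, ← maj_eq_s6, ← bast6_eq (good_pf _)] at key
  exact key


end MahonianStats
end
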